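/- arXiv:2512.10556 — 7 statements merged into one kernel-verified Lean document; each statement's English description precedes it below -/
import Mathlib

section
/- Let Λ ∈ V, let u be a positive integer and K ∈ ℚ, and assume: (a) (Λ+ρ|γ) is not a nonpositive integer for every γ ∈ Δ^{∨re}₊; (b) Δ^{∨re}_Λ = Δ^{∨re}_{(u)}; (c) (Λ|δ) = K. Then: (1) u is odd; (2) p := u(K+3) is an integer with p ≥ 2 and gcd(u,p) = 1; (3) there exist positive integers n₁, n₂ with n₁ < 2p, n₂ < 2p and n₁ + n₂ odd, and a scalar s ∈ ℂ, such that Λ + ρ = (K+3)Λ₀ + (n₁/2)α₁ + (n₂/2)(α₁+α₂) + sδ. -/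
noncomputable section

open Complex

/-- The complex vector space with basis `{Λ₀, α₁, α₂, δ}`. -/
abbrev V4 : Type := Fin 4 → ℂ

def Lam0 : V4 := ![1, 0, 0, 0]
def al1 : V4 := ![0, 1, 0, 0]
def al2 : V4 := ![0, 0, 1, 0]
def del : V4 := ![0, 0, 0, 1]

/-- The symmetric bilinear form `(·|·)` determined by `(α₁|α₁)=1`, `(α₂|α₂)=2`,
`(α₁|α₂)=−1`, `(δ|·)=0` except `(Λ₀|δ)=1`, `(Λ₀|·)=0` otherwise. -/
def B (x y : V4) : ℂ :=
  x 0 * y 3 + x 3 * y 0 + x 1 * y 1 - x 1 * y 2 - x 2 * y 1 + 2 * (x 2 * y 2)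

/-- The Weyl vector `ρ = 3Λ₀ + 2α₁ + (3/2)α₂`. -/
def rhoV : V4 := (3 : ℂ) • Lam0 + (2 : ℂ) • al1 + (3 / 2 : ℂ) • al2

/-- `α₁^∨ = 2α₁`. -/
def a1v : V4 := (2 : ℂ) • al1
/-- `α₂^∨ = α₂`. -/
def a2v : V4 := al2

/-- The set of real coroots `Δ^{∨re}` of `C₂⁽¹⁾` (with `c = δ`). -/
def CorootSet : Set V4 :=
  {γ | ∃ n : ℤ,
    γ = (2 * n) • del + a1v ∨ γ = (2 * n) • del - a1v ∨
    γ = (2 * n) • del + (a1v + (2 : ℂ) • a2v) ∨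
    γ = (2 * n) • del - (a1v + (2 : ℂ) • a2v) ∨
    γ = n • del + a2v ∨ γ = n • del - a2v ∨
    γ = n • del + (a1v + a2v) ∨ γ = n • del - (a1v + a2v)}

/-- The positive real coroots: `γ ∈ Δ^{∨re}` with `(ρ|γ) > 0`. -/
def PosCoroots : Set V4 :=
  {γ | γ ∈ CorootSet ∧ ∃ r : ℝ, 0 < r ∧ B rhoV γ = (r : ℂ)}

/-- The set `Δ^{∨re}_{(u)} = {2nuc ± α₁^∨, 2nuc ± (α₁^∨+2α₂^∨) : n ∈ ℤ}`. -/
def CorootU (u : ℕ) : Set V4 :=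
  {γ | ∃ n : ℤ,
    γ = (2 * n * u) • del + a1v ∨ γ = (2 * n * u) • del - a1v ∨
    γ = (2 * n * u) • del + (a1v + (2 : ℂ) • a2v) ∨
    γ = (2 * n * u) • del - (a1v + (2 : ℂ) • a2v)}

/-- `Δ^{∨re}_Λ = {γ ∈ Δ^{∨re} : (Λ+ρ|γ) ∈ ℤ}`. -/
def CorootLam (Λ : V4) : Set V4 :=
  {γ | γ ∈ CorootSet ∧ ∃ k : ℤ, B (Λ + rhoV) γ = (k : ℂ)}

theorem B_sd (M : V4) (m : ℤ) (v : V4) : B M (m • del + v) = m * M 0 + B M v := by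
  simp [B, del]; ring
theorem B_sd' (M : V4) (m : ℤ) (v : V4) : B M (m • del - v) = m * M 0 - B M v := by
  simp [B, del]; ring
theorem B_1 (M : V4) : B M a1v = 2 * (M 1 - M 2) := by
  simp [B, a1v, al1]; ring
theorem B_2 (M : V4) : B M (a1v + (2 : ℂ) • a2v) = 2 * M 2 := by
  simp [B, a1v, a2v, al1, al2]; ring
theorem B_3 (M : V4) : B M (a1v + a2v) = M 1 := by
  simp [B, a1v, a2v, al1, al2]; ring

theorem notU3 (u : ℕ) (m : ℤ) : m • del + (a1v + a2v) ∉ CorootU u := by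
  rintro ⟨n, h | h | h | h⟩ <;>
  · have h1 := congrFun h 1
    have h2 := congrFun h 2
    simp only [del, a1v, a2v, al1, al2, Pi.add_apply, Pi.sub_apply, Pi.smul_apply,
      Matrix.cons_val, smul_zero, smul_eq_mul] at h1 h2
    first | (exfalso; norm_num at h1; done) | (exfalso; norm_num at h2; done)

theorem notU1 (u : ℕ) (m : ℤ) (h : (2 * m) • del + a1v ∈ CorootU u) : (u : ℤ) ∣ m := by
  obtain ⟨n, h | h | h | h⟩ := h
  · have h3 := congrFun h 3
    simp [del, a1v, al1] at h3
    refine ⟨n, ?_⟩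
    have : ((2 * m : ℤ) : ℂ) = ((2 * n * u : ℤ) : ℂ) := by push_cast; linear_combination h3
    have := Int.cast_injective this
    linarith
  all_goals
    have h1 := congrFun h 1
    have h2 := congrFun h 2
    simp only [del, a1v, a2v, al1, al2, Pi.add_apply, Pi.sub_apply, Pi.smul_apply,
      Matrix.cons_val, smul_zero, smul_eq_mul] at h1 h2
    first | (exfalso; norm_num at h1; done) | (exfalso; norm_num at h2; done)

/-- If `Λ ∈ V`, `u` is a positive integer, `K ∈ ℚ`, and
(a) `(Λ+ρ|γ)` is not a nonpositive integer for every positive real coroot `γ`;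
(b) `Δ^{∨re}_Λ = Δ^{∨re}_{(u)}`; (c) `(Λ|δ) = K`; then `u` is odd,
`p := u(K+3)` is an integer `≥ 2` coprime to `u`, and
`Λ + ρ = (K+3)Λ₀ + (n₁/2)α₁ + (n₂/2)(α₁+α₂) + sδ` for some positive integers
`n₁, n₂ < 2p` with `n₁ + n₂` odd and some scalar `s ∈ ℂ`. -/
theorem statement0 (Λ : V4) (u : ℕ) (hu : 0 < u) (K : ℚ)
    (ha : ∀ γ ∈ PosCoroots, ¬ ∃ k : ℤ, k ≤ 0 ∧ B (Λ + rhoV) γ = (k : ℂ))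
    (hb : CorootLam Λ = CorootU u)
    (hc : B Λ del = (K : ℂ)) :
    Odd u ∧
    (∃ p : ℤ, (p : ℚ) = (u : ℚ) * (K + 3) ∧ 2 ≤ p ∧ Int.gcd (u : ℤ) p = 1) ∧
    (∃ p : ℤ, (p : ℚ) = (u : ℚ) * (K + 3) ∧
      ∃ n₁ n₂ : ℕ, 0 < n₁ ∧ 0 < n₂ ∧ (n₁ : ℤ) < 2 * p ∧ (n₂ : ℤ) < 2 * p ∧
        Odd (n₁ + n₂) ∧
        ∃ s : ℂ, Λ + rhoV =
          ((K : ℂ) + 3) • Lam0 + ((n₁ : ℂ) / 2) • al1 +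
            ((n₂ : ℂ) / 2) • (al1 + al2) + s • del) := by
  have hM0 : (Λ + rhoV) 0 = (K : ℂ) + 3 := by
    have : Λ 0 = K := by rw [← hc]; simp [B, del]
    simp [rhoV, Lam0, al1, al2, this]
  have r0 : rhoV 0 = 3 := by simp [rhoV, Lam0, al1, al2]
  have r1 : rhoV 1 = 2 := by simp [rhoV, Lam0, al1, al2]
  have r2 : rhoV 2 = 3 / 2 := by simp [rhoV, Lam0, al1, al2]
  generalize hM : Λ + rhoV = M at *
  have mem : ∀ γ, γ ∈ CorootU u ↔ (γ ∈ CorootSet ∧ ∃ k : ℤ, B M γ = k) := by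
    intro γ; rw [← hb, ← hM]; rfl
  -- the basic integers
  obtain ⟨n1, hn1⟩ : ∃ k : ℤ, 2 * (M 1 - M 2) = k := by
    rw [← B_1]; exact ((mem _).1 ⟨0, by simp⟩).2
  obtain ⟨n2, hn2⟩ : ∃ k : ℤ, 2 * M 2 = k := by
    rw [← B_2]; exact ((mem _).1 ⟨0, by simp⟩).2
  obtain ⟨q, hq⟩ : ∃ k : ℤ, 2 * u * (K + 3) = (k : ℂ) := by
    obtain ⟨k, hk⟩ := ((mem ((2 * 1 * (u : ℤ)) • del + a1v)).1 ⟨1, Or.inl rfl⟩).2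
    rw [B_sd, B_1, hM0, hn1] at hk
    refine ⟨k - n1, ?_⟩
    push_cast at hk ⊢
    linear_combination hk
  have key : ∀ n k : ℤ, 2 * n * ((K : ℂ) + 3) = k → (u : ℤ) ∣ n := by
    intro n k h
    apply notU1
    rw [mem]
    refine ⟨⟨n, Or.inl rfl⟩, k + n1, ?_⟩
    rw [B_sd, B_1, hM0, hn1]
    push_cast
    linear_combination h
  have key3 : ∀ n k : ℤ, 2 * n * ((K : ℂ) + 3) + n1 + 2 * n2 - n2 ≠ 2 * k := by
    intro n k h
    apply notU3 u n
    rw [mem]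
    refine ⟨⟨n, by tauto⟩, k, ?_⟩
    rw [B_sd, B_3, hM0]
    linear_combination (1 / 2 : ℂ) * h + (1 / 2 : ℂ) * hn1 + (1 / 2 : ℂ) * hn2
  have hodd : Odd (n1 + n2) := by
    rw [← Int.not_even_iff_odd]
    rintro ⟨k, hk⟩
    apply key3 0 k
    have : (n1 : ℂ) + n2 = k + k := by exact_mod_cast hk
    push_cast
    linear_combination this
  have hqe : Even q := by
    rw [← Int.not_odd_iff_even]
    intro ho
    obtain ⟨k, hk⟩ := ho.add_odd hodd
    apply key3 u k
    have : (q : ℂ) + (n1 + n2) = k + k := by exact_mod_cast hk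
    push_cast
    linear_combination this + hq
  obtain ⟨p, rfl⟩ := hqe
  have hp : (u : ℂ) * (K + 3) = p := by
    push_cast at hq
    linear_combination (1 / 2 : ℂ) * hq
  have hpQ : (p : ℚ) = (u : ℚ) * (K + 3) := by
    exact_mod_cast hp.symm
  have hu0 : (u : ℂ) ≠ 0 := by exact_mod_cast hu.ne'
  have uodd : Odd u := by
    rw [← Nat.not_even_iff_odd]
    rintro ⟨v, rfl⟩
    have := key v p (by push_cast at hp ⊢; linear_combination hp)
    have := Int.le_of_dvd (by omega) this
    omega
  have hgcd : Int.gcd (u : ℤ) p = 1 := by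
    obtain ⟨u', hu'⟩ := Int.gcd_dvd_left (u : ℤ) p
    obtain ⟨p', hp'⟩ := Int.gcd_dvd_right (u : ℤ) p
    have hgpos : 0 < Int.gcd (u : ℤ) p := Int.gcd_pos_of_ne_zero_left _ (by omega)
    generalize Int.gcd (u : ℤ) p = g at *
    have hg0 : (g : ℂ) ≠ 0 := by exact_mod_cast hgpos.ne'
    have e1 : (u : ℂ) = g * u' := by exact_mod_cast hu'
    have e2 : (p : ℂ) = g * p' := by exact_mod_cast hp'
    have := key u' (2 * p') (by
      apply mul_left_cancel₀ hg0
      push_cast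
      rw [e1, e2] at hp
      linear_combination 2 * hp)
    have hpos : 0 < u' := by
      by_contra hneg
      have : (g : ℤ) * u' ≤ 0 := mul_nonpos_of_nonneg_of_nonpos (by omega) (by omega)
      omega
    have := Int.le_of_dvd hpos this
    by_contra hne
    have : (2 : ℤ) ≤ g := by omega
    nlinarith
  have pos : ∀ γ ∈ CorootSet, ∀ r : ℤ, 0 < r → B rhoV γ = r → ∀ k : ℤ, B M γ = k → 0 < k := by
    intro γ hγ r hr hB k hk
    by_contra hneg
    exact ha γ ⟨hγ, r, by exact_mod_cast hr, by rw [hB]; norm_cast⟩ ⟨k, by omega, hk⟩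
  have p1 : 0 < n1 := pos a1v ⟨0, by simp⟩ 1 (by norm_num)
    (by rw [B_1, r1, r2]; norm_num) n1 (by rw [B_1, hn1])
  have p2 : 0 < n2 := pos (a1v + (2 : ℂ) • a2v) ⟨0, by simp⟩ 3 (by norm_num)
    (by rw [B_2, r2]; norm_num) n2 (by rw [B_2, hn2])
  have p3 : 0 < 2 * p - n1 := pos ((2 * (u : ℤ)) • del - a1v) ⟨u, by tauto⟩ (6 * u - 1) (by omega)
    (by rw [B_sd', B_1, r0, r1, r2]; push_cast; ring) _
    (by rw [B_sd', B_1, hn1, hM0]; push_cast; linear_combination 2 * hp)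
  have p4 : 0 < 2 * p - n2 := pos ((2 * (u : ℤ)) • del - (a1v + (2 : ℂ) • a2v))
    ⟨u, by tauto⟩ (6 * u - 3) (by omega)
    (by rw [B_sd', B_2, r0, r2]; push_cast; ring) _
    (by rw [B_sd', B_2, hn2, hM0]; push_cast; linear_combination 2 * hp)
  lift n1 to ℕ using p1.le
  lift n2 to ℕ using p2.le
  have hodd' : Odd (n1 + n2) := by exact_mod_cast hodd
  refine ⟨uodd, ⟨p, hpQ, ?_, hgcd⟩, p, hpQ, n1, n2, by omega, by omega, by omega, by omega,
    hodd', M 3, ?_⟩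
  · obtain ⟨k, hk⟩ := hodd'
    omega
  · push_cast at hn1 hn2
    ext i
    fin_cases i
    · simp [Lam0, al1, al2, del, hM0]
    · simp [Lam0, al1, al2, del]
      linear_combination (1 / 2 : ℂ) * hn1 + (1 / 2 : ℂ) * hn2
    · simp [Lam0, al1, al2, del]
      linear_combination (1 / 2 : ℂ) * hn2
    · simp [Lam0, al1, al2, del]


end
end

section
/- For K ∈ ℚ and a positive integer u: (1) P_K⁺(S^∨_{(u)}) ≠ ∅ if and only if u is odd, u(K+3) is an integer ≥ 2, and gcd(u, u(K+3)) = 1. (2) When these conditions hold, P_K⁺(S^∨_{(u)}) = { Λ^{[K]}_{n₁,n₂} : n₁, n₂ positive integers, n₁ < 2u(K+3), n₂ < 2u(K+3), n₁ − n₂ odd }. (3) In particular, if Λ^{[K]}_{n₁,n₂} ∈ P_K⁺(S^∨_{(u)}) then Λ^{[K]}_{2u(K+3)−n₁, n₂}, Λ^{[K]}_{n₁, 2u(K+3)−n₂} and Λ^{[K]}_{2u(K+3)−n₁, 2u(K+3)−n₂} also lie in P_K⁺(S^∨_{(u)}). -/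
noncomputable section

open Complex

/-- `Λ` is an admissible weight of type `S^∨_{(u)}` and level `K`. -/
def IsAdmissible (u : ℕ) (K : ℚ) (Λ : V4) : Prop :=
  Λ ∈ Submodule.span ℂ ({Lam0, al1, al2} : Set V4) ∧
  (∀ γ ∈ PosCoroots, ¬ ∃ k : ℤ, k ≤ 0 ∧ B (Λ + rhoV) γ = (k : ℂ)) ∧
  CorootLam Λ = CorootU u ∧
  B Λ del = (K : ℂ)

/-- The set `P_K⁺(S^∨_{(u)})` of admissible weights of type `S^∨_{(u)}` and level `K`. -/
def Padm (u : ℕ) (K : ℚ) : Set V4 := {Λ | IsAdmissible u K Λ}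

/-- The weight `Λ^{[K]}_{n₁,n₂} = KΛ₀ + ((n₁−1)/2)α₁ + ((n₂−3)/2)(α₁+α₂)`. -/
def LamW (K : ℚ) (n₁ n₂ : ℤ) : V4 :=
  (K : ℂ) • Lam0 + (((n₁ : ℂ) - 1) / 2) • al1 + (((n₂ : ℂ) - 3) / 2) • (al1 + al2)

lemma B_a1 (Λ : V4) (n : ℤ) : B (Λ + rhoV) ((2 * n) • del + a1v)
    = 2 * n * (Λ 0 + 3) + (2 * Λ 1 - 2 * Λ 2 + 1) := by
  simp [B, rhoV, Lam0, al1, al2, del, a1v]; ring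
lemma B_a1' (Λ : V4) (n : ℤ) : B (Λ + rhoV) ((2 * n) • del - a1v)
    = 2 * n * (Λ 0 + 3) - (2 * Λ 1 - 2 * Λ 2 + 1) := by
  simp [B, rhoV, Lam0, al1, al2, del, a1v]; ring
lemma B_b (Λ : V4) (n : ℤ) : B (Λ + rhoV) ((2 * n) • del + (a1v + (2 : ℂ) • a2v))
    = 2 * n * (Λ 0 + 3) + (2 * Λ 2 + 3) := by
  simp [B, rhoV, Lam0, al1, al2, del, a1v, a2v]; ring
lemma B_b' (Λ : V4) (n : ℤ) : B (Λ + rhoV) ((2 * n) • del - (a1v + (2 : ℂ) • a2v))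
    = 2 * n * (Λ 0 + 3) - (2 * Λ 2 + 3) := by
  simp [B, rhoV, Lam0, al1, al2, del, a1v, a2v]; ring
lemma B_c (Λ : V4) (n : ℤ) : B (Λ + rhoV) (n • del + a2v)
    = n * (Λ 0 + 3) + (2 * Λ 2 - Λ 1 + 1) := by
  simp [B, rhoV, Lam0, al1, al2, del, a2v]; ring
lemma B_c' (Λ : V4) (n : ℤ) : B (Λ + rhoV) (n • del - a2v)
    = n * (Λ 0 + 3) - (2 * Λ 2 - Λ 1 + 1) := by
  simp [B, rhoV, Lam0, al1, al2, del, a2v]; ring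
lemma B_d (Λ : V4) (n : ℤ) : B (Λ + rhoV) (n • del + (a1v + a2v))
    = n * (Λ 0 + 3) + (Λ 1 + 2) := by
  simp [B, rhoV, Lam0, al1, al2, del, a1v, a2v]; ring
lemma B_d' (Λ : V4) (n : ℤ) : B (Λ + rhoV) (n • del - (a1v + a2v))
    = n * (Λ 0 + 3) - (Λ 1 + 2) := by
  simp [B, rhoV, Lam0, al1, al2, del, a1v, a2v]; ring

lemma a1_mem (u : ℕ) (n : ℤ) (h : (2 * n) • del + a1v ∈ CorootU u) : ∃ m : ℤ, n = m * u := by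
  obtain ⟨m, h | h | h | h⟩ := h
  all_goals
    have h1 := congr_fun h 1
    have h2 := congr_fun h 2
    have h3 := congr_fun h 3
    simp [al1, al2, del, a1v, a2v] at h1 h2 h3
  · refine ⟨m, ?_⟩
    have : (n : ℂ) = m * u := by linear_combination h3 / 2
    exact_mod_cast this
  · norm_num [Complex.ext_iff] at h1

lemma c_mem (u : ℕ) (n : ℤ) (h : n • del + a2v ∈ CorootU u) : False := by
  obtain ⟨m, h | h | h | h⟩ := h
  all_goals
    have h1 := congr_fun h 1
    simp [al1, al2, del, a1v, a2v] at h1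

lemma rho_pos (γ : V4) (h : γ ∈ CorootSet) (r : ℤ) (hr : 0 < r) (hB : B rhoV γ = r) :
    γ ∈ PosCoroots := ⟨h, r, by exact_mod_cast hr, by rw [hB]; simp⟩

lemma fwd (u : ℕ) (hu : 0 < u) (K : ℚ) (Λ : V4) (h : IsAdmissible u K Λ) :
    Odd u ∧ ∃ p : ℤ, (p : ℚ) = (u : ℚ) * (K + 3) ∧ 2 ≤ p ∧ Int.gcd (u : ℤ) p = 1 ∧
      ∃ n₁ n₂ : ℤ, 0 < n₁ ∧ 0 < n₂ ∧ n₁ < 2 * p ∧ n₂ < 2 * p ∧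
          Odd (n₁ - n₂) ∧ Λ = LamW K n₁ n₂ := by
  obtain ⟨hs, ha, hb, hc⟩ := h
  have hu' : (u : ℂ) ≠ 0 := by exact_mod_cast hu.ne'
  have h3 : Λ 3 = 0 := by
    have : Submodule.span ℂ ({Lam0, al1, al2} : Set V4) ≤
        LinearMap.ker (LinearMap.proj 3 : V4 →ₗ[ℂ] ℂ) := by
      rw [Submodule.span_le]
      rintro x (rfl | rfl | rfl) <;> simp [Lam0, al1, al2]
    simpa using this hs
  have h0 : Λ 0 = K := by simpa [B, del] using hc
  have key : ∀ γ, γ ∈ CorootU u → ∃ k : ℤ, B (Λ + rhoV) γ = k := fun γ hγ => by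
    rw [← hb] at hγ; exact hγ.2
  have key2 : ∀ γ, γ ∈ CorootSet → ∀ k : ℤ, B (Λ + rhoV) γ = k → γ ∈ CorootU u :=
    fun γ h1 k hk => by rw [← hb]; exact ⟨h1, k, hk⟩
  obtain ⟨n₁, hn₁⟩ := key ((2 * (0:ℤ)) • del + a1v) ⟨0, by simp⟩
  obtain ⟨n₂, hn₂⟩ := key ((2 * (0:ℤ)) • del + (a1v + (2 : ℂ) • a2v)) ⟨0, by simp⟩
  obtain ⟨j, hj⟩ := key ((2 * (u:ℤ)) • del + a1v) ⟨1, by simp⟩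
  have e1 := hn₁; have e2 := hn₂
  rw [B_a1] at e1 hj
  rw [B_b] at e2
  push_cast at e1 e2 hj
  have hc : ∀ n k : ℤ, (n : ℂ) * (Λ 0 + 3) + (2 * Λ 2 - Λ 1 + 1) ≠ k := fun n k hk =>
    c_mem u n (key2 _ ⟨n, by simp⟩ k (by rw [B_c, hk]))
  have hq : 2 * (u : ℂ) * (Λ 0 + 3) = (j - n₁ : ℤ) := by
    push_cast; linear_combination hj - e1
  have hodd : Odd (n₁ - n₂) := by
    by_contra hno
    rw [Int.not_odd_iff_even] at hno
    obtain ⟨t, ht⟩ := hno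
    have ht : (n₁ : ℂ) - n₂ = t + t := by exact_mod_cast ht
    apply hc 0 (-t)
    push_cast
    linear_combination (e2 - e1 - ht) / 2
  obtain ⟨p, hp⟩ : Even (j - n₁) := by
    by_contra hno
    rw [Int.not_even_iff_odd] at hno
    obtain ⟨t, ht⟩ := hno.sub_odd hodd
    have ht : (j : ℂ) - n₁ - (n₁ - n₂) = t + t := by exact_mod_cast ht
    apply hc u t
    push_cast at hq ⊢
    linear_combination (e2 - e1 + ht + hq) / 2
  rw [hp] at hq
  push_cast at hq
  have hq' : (u : ℂ) * (Λ 0 + 3) = p := by linear_combination hq / 2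
  have hpQ : (p : ℚ) = (u : ℚ) * (K + 3) := by
    rw [h0] at hq'
    exact_mod_cast hq'.symm
  have hg : Int.gcd (u : ℤ) (2 * p) = 1 := by
    obtain ⟨u', hu1⟩ := Int.gcd_dvd_left (a := (u : ℤ)) (b := 2 * p)
    obtain ⟨q', hq1⟩ := Int.gcd_dvd_right (a := (u : ℤ)) (b := 2 * p)
    set d := Int.gcd (u : ℤ) (2 * p) with hd
    have hu1c : (u : ℂ) = d * u' := by exact_mod_cast hu1
    have hq1c : 2 * (p : ℂ) = d * q' := by exact_mod_cast hq1
    have hd0 : (d : ℂ) ≠ 0 := by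
      intro h; rw [h] at hu1c; simp at hu1c; exact hu.ne' hu1c
    have hk : 2 * (u' : ℂ) * (Λ 0 + 3) = q' := by
      apply mul_left_cancel₀ hd0
      rw [← hq1c, ← hq', hu1c]; ring
    obtain ⟨m, hm⟩ := a1_mem u u' (key2 _ ⟨u', by simp⟩ (q' + n₁) (by
      rw [B_a1]; push_cast; linear_combination hk + e1))
    have hu0 : (u : ℤ) ≠ 0 := by exact_mod_cast hu.ne'
    have : (u : ℤ) * 1 = u * (d * m) := by rw [hm] at hu1; linear_combination hu1
    have := mul_left_cancel₀ hu0 this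
    have h2 : (d : ℤ) ∣ 1 := ⟨m, this⟩
    have := Int.eq_one_of_dvd_one (by positivity) h2
    exact_mod_cast this
  have hcop : IsCoprime (u : ℤ) (2 * p) := Int.isCoprime_iff_gcd_eq_one.2 hg
  have hou : Odd u := by
    have := hcop.of_mul_right_left
    have := Int.isCoprime_iff_gcd_eq_one.1 this
    have : Nat.Coprime u 2 := by simpa [Int.gcd] using this
    exact Nat.coprime_two_right.1 this
  have p1 : 0 < n₁ := by
    by_contra hno
    exact ha _ (rho_pos ((2 * (0:ℤ)) • del + a1v) ⟨0, by simp⟩ 1 (by norm_num)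
      (by have := B_a1 0 0; rw [zero_add] at this; rw [this]; simp)) ⟨n₁, by omega, hn₁⟩
  have p2 : 0 < n₂ := by
    by_contra hno
    exact ha _ (rho_pos ((2 * (0:ℤ)) • del + (a1v + (2 : ℂ) • a2v)) ⟨0, by simp⟩ 3 (by norm_num)
      (by have := B_b 0 0; rw [zero_add] at this; rw [this]; simp)) ⟨n₂, by omega, hn₂⟩
  have p3 : n₁ < 2 * p := by
    by_contra hno
    refine ha _ (rho_pos ((2 * (u:ℤ)) • del - a1v) ⟨u, by simp⟩ (6 * u - 1) (by omega)
      (by have := B_a1' 0 u; rw [zero_add] at this; rw [this]; simp; ring)) 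
      ⟨2 * p - n₁, by omega, ?_⟩
    rw [B_a1']; push_cast; linear_combination hq - e1
  have p4 : n₂ < 2 * p := by
    by_contra hno
    refine ha _ (rho_pos ((2 * (u:ℤ)) • del - (a1v + (2 : ℂ) • a2v)) ⟨u, by simp⟩ (6 * u - 3)
      (by omega)
      (by have := B_b' 0 u; rw [zero_add] at this; rw [this]; simp; ring)) 
      ⟨2 * p - n₂, by omega, ?_⟩
    rw [B_b']; push_cast; linear_combination hq - e2
  refine ⟨hou, p, hpQ, ?_, Int.isCoprime_iff_gcd_eq_one.1 hcop.of_mul_right_right,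
    n₁, n₂, p1, p2, p3, p4, hodd, ?_⟩
  · obtain ⟨t, ht⟩ := hodd
    omega
  · ext i
    fin_cases i
    · simp [LamW, Lam0, al1, al2, h0]
    · simp [LamW, Lam0, al1, al2]; linear_combination (e1 + e2) / 2
    · simp [LamW, Lam0, al1, al2]; linear_combination e2 / 2
    · simp [LamW, Lam0, al1, al2, h3]

lemma div_aux (u : ℕ) (p : ℤ) (hou : Odd u) (hg : Int.gcd (u : ℤ) p = 1) (k : ℂ)
    (hk : (u : ℂ) * k = p) (n t : ℤ) (h : 2 * (n : ℂ) * k = t) : ∃ m : ℤ, n = m * u := by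
  have h1 : (2 * n * p : ℂ) = u * t := by rw [← h, ← hk]; ring
  have h1 : 2 * n * p = u * t := by exact_mod_cast h1
  have c1 : IsCoprime (u : ℤ) p := Int.isCoprime_iff_gcd_eq_one.2 hg
  have c2 : IsCoprime (u : ℤ) 2 := by
    rw [Int.isCoprime_iff_gcd_eq_one]
    have := Nat.coprime_two_right.2 hou
    simpa [Int.gcd] using this
  have h2 : (u : ℤ) ∣ 2 * n := c1.dvd_of_dvd_mul_right ⟨t, h1⟩
  obtain ⟨m, hm⟩ := c2.dvd_of_dvd_mul_left h2
  exact ⟨m, by rw [hm]; ring⟩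

lemma half_aux (u : ℕ) (p : ℤ) (hou : Odd u) (k : ℂ)
    (hk : (u : ℂ) * k = p) (n t : ℤ) (ht : Odd t) (h : 2 * (n : ℂ) * k = t) : False := by
  have h1 : (2 * n * p : ℂ) = u * t := by rw [← h, ← hk]; ring
  have h1 : 2 * n * p = u * t := by exact_mod_cast h1
  have h2 : Odd ((u : ℤ) * t) := Odd.mul (by exact_mod_cast hou) ht
  rw [← h1, mul_assoc] at h2
  exact (Int.not_odd_iff_even.2 (even_two_mul _)) h2

lemma bwd (u : ℕ) (hu : 0 < u) (K : ℚ) (p : ℤ) (hp : (p : ℚ) = (u : ℚ) * (K + 3))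
    (hg : Int.gcd (u : ℤ) p = 1) (hou : Odd u) (n₁ n₂ : ℤ) (p1 : 0 < n₁) (p2 : 0 < n₂)
    (p3 : n₁ < 2 * p) (p4 : n₂ < 2 * p) (hodd : Odd (n₁ - n₂)) :
    IsAdmissible u K (LamW K n₁ n₂) := by
  obtain ⟨Λ, hΛ⟩ : ∃ Λ, Λ = LamW K n₁ n₂ := ⟨_, rfl⟩
  have h0 : Λ 0 = K := by simp [hΛ, LamW, Lam0, al1, al2]
  have h1 : Λ 1 = (n₁ - 1) / 2 + (n₂ - 3) / 2 := by simp [hΛ, LamW, Lam0, al1, al2]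
  have h2 : Λ 2 = (n₂ - 3) / 2 := by simp [hΛ, LamW, Lam0, al1, al2]
  have e1 : 2 * Λ 1 - 2 * Λ 2 + 1 = n₁ := by rw [h1, h2]; ring
  have e2 : 2 * Λ 2 + 3 = n₂ := by rw [h2]; ring
  have e3 : 2 * (2 * Λ 2 - Λ 1 + 1) = n₂ - n₁ := by rw [h1, h2]; ring
  have e4 : 2 * (Λ 1 + 2) = n₂ + n₁ := by rw [h1]; ring
  have hk : (u : ℂ) * (Λ 0 + 3) = p := by rw [h0]; exact_mod_cast hp.symm
  have hkm : ∀ m : ℤ, 2 * ((m * u : ℤ) : ℂ) * (Λ 0 + 3) = (2 * m * p : ℤ) := fun m => by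
    push_cast; rw [← hk]; ring
  have hd := div_aux u p hou hg _ hk
  have hh := half_aux u p hou _ hk
  have hmain : CorootLam Λ = CorootU u := by
    ext γ
    constructor
    · rintro ⟨⟨n, h | h | h | h | h | h | h | h⟩, k, hB⟩ <;> subst h
      · rw [B_a1, e1] at hB
        obtain ⟨m, rfl⟩ := hd n (k - n₁) (by push_cast; linear_combination hB)
        exact ⟨m, by simp [mul_assoc]⟩
      · rw [B_a1', e1] at hB
        obtain ⟨m, rfl⟩ := hd n (k + n₁) (by push_cast; linear_combination hB)
        exact ⟨m, by simp [mul_assoc]⟩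
      · rw [B_b, e2] at hB
        obtain ⟨m, rfl⟩ := hd n (k - n₂) (by push_cast; linear_combination hB)
        exact ⟨m, by simp [mul_assoc]⟩
      · rw [B_b', e2] at hB
        obtain ⟨m, rfl⟩ := hd n (k + n₂) (by push_cast; linear_combination hB)
        exact ⟨m, by simp [mul_assoc]⟩
      · rw [B_c] at hB
        refine (hh n (2 * k + (n₁ - n₂)) (by grind) ?_).elim
        push_cast; linear_combination 2 * hB - e3
      · rw [B_c'] at hB
        refine (hh n (2 * k - (n₁ - n₂)) (by grind) ?_).elim
        push_cast; linear_combination 2 * hB + e3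
      · rw [B_d] at hB
        refine (hh n (2 * k - (n₁ + n₂)) (by grind) ?_).elim
        push_cast; linear_combination 2 * hB - e4
      · rw [B_d'] at hB
        refine (hh n (2 * k + (n₁ + n₂)) (by grind) ?_).elim
        push_cast; linear_combination 2 * hB + e4
    · rintro ⟨m, h | h | h | h⟩ <;> rw [mul_assoc] at h <;> subst h <;>
        refine ⟨⟨m * u, by simp⟩, ?_⟩
      · exact ⟨2 * m * p + n₁, by rw [B_a1, e1, hkm]; push_cast; ring⟩
      · exact ⟨2 * m * p - n₁, by rw [B_a1', e1, hkm]; push_cast; ring⟩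
      · exact ⟨2 * m * p + n₂, by rw [B_b, e2, hkm]; push_cast; ring⟩
      · exact ⟨2 * m * p - n₂, by rw [B_b', e2, hkm]; push_cast; ring⟩
  rw [← hΛ]
  refine ⟨?_, ?_, hmain, ?_⟩
  · rw [hΛ, LamW]
    have m0 : Lam0 ∈ Submodule.span ℂ ({Lam0, al1, al2} : Set V4) :=
      Submodule.subset_span (by simp)
    have m1 : al1 ∈ Submodule.span ℂ ({Lam0, al1, al2} : Set V4) :=
      Submodule.subset_span (by simp)
    have m2 : al2 ∈ Submodule.span ℂ ({Lam0, al1, al2} : Set V4) :=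
      Submodule.subset_span (by simp)
    exact add_mem (add_mem (Submodule.smul_mem _ _ m0) (Submodule.smul_mem _ _ m1))
      (Submodule.smul_mem _ _ (add_mem m1 m2))
  · rintro γ ⟨hγ, r, hr, hρ⟩ ⟨k, hk0, hB⟩
    have hγU : γ ∈ CorootU u := by rw [← hmain]; exact ⟨hγ, k, hB⟩
    have hup : (1 : ℤ) ≤ u := by exact_mod_cast hu
    obtain ⟨m, h | h | h | h⟩ := hγU <;> rw [mul_assoc] at h <;> subst h
    · have hr' := B_a1 0 (m * u)
      rw [zero_add, hρ] at hr'
      have hr2 : r = ((6 * (m * u) + 1 : ℤ) : ℝ) := by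
        apply Complex.ofReal_injective
        rw [hr']; simp; ring
      rw [hr2] at hr
      have hr : 0 < 6 * (m * u) + 1 := by exact_mod_cast hr
      have hm : 0 ≤ m := by by_contra hno; nlinarith
      rw [B_a1, e1, hkm] at hB
      have hB : 2 * m * p + n₁ = k := by exact_mod_cast hB
      nlinarith
    · have hr' := B_a1' 0 (m * u)
      rw [zero_add, hρ] at hr'
      have hr2 : r = ((6 * (m * u) - 1 : ℤ) : ℝ) := by
        apply Complex.ofReal_injective
        rw [hr']; simp; ring
      rw [hr2] at hr
      have hr : 0 < 6 * (m * u) - 1 := by exact_mod_cast hr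
      have hm : 1 ≤ m := by by_contra hno; nlinarith
      rw [B_a1', e1, hkm] at hB
      have hB : 2 * m * p - n₁ = k := by exact_mod_cast hB
      nlinarith
    · have hr' := B_b 0 (m * u)
      rw [zero_add, hρ] at hr'
      have hr2 : r = ((6 * (m * u) + 3 : ℤ) : ℝ) := by
        apply Complex.ofReal_injective
        rw [hr']; simp; ring
      rw [hr2] at hr
      have hr : 0 < 6 * (m * u) + 3 := by exact_mod_cast hr
      have hm : 0 ≤ m := by by_contra hno; nlinarith
      rw [B_b, e2, hkm] at hB
      have hB : 2 * m * p + n₂ = k := by exact_mod_cast hB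
      nlinarith
    · have hr' := B_b' 0 (m * u)
      rw [zero_add, hρ] at hr'
      have hr2 : r = ((6 * (m * u) - 3 : ℤ) : ℝ) := by
        apply Complex.ofReal_injective
        rw [hr']; simp; ring
      rw [hr2] at hr
      have hr : 0 < 6 * (m * u) - 3 := by exact_mod_cast hr
      have hm : 1 ≤ m := by by_contra hno; nlinarith
      rw [B_b', e2, hkm] at hB
      have hB : 2 * m * p - n₂ = k := by exact_mod_cast hB
      nlinarith
  · simp [B, del, h0]

lemma LamW_inj (K : ℚ) (a b c d : ℤ) (h : LamW K a b = LamW K c d) : a = c ∧ b = d := by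
  have h1 := congr_fun h 1
  have h2 := congr_fun h 2
  simp only [LamW, Lam0, al1, al2] at h1 h2
  simp at h1 h2
  have h3 : (b : ℂ) = d := by exact_mod_cast h2
  have h4 : (a : ℂ) = c := by rw [h3] at h1; linear_combination 2 * h1
  exact ⟨by exact_mod_cast h4, by exact_mod_cast h3⟩

/-- (1) `P_K⁺(S^∨_{(u)}) ≠ ∅` iff `u` is odd, `u(K+3)` is an
integer `≥ 2`, and `gcd(u, u(K+3)) = 1`.  (2) In that case `P_K⁺(S^∨_{(u)})`
consists exactly of the weights `Λ^{[K]}_{n₁,n₂}` with `n₁, n₂` positive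
integers `< 2u(K+3)` and `n₁ − n₂` odd.  (3) In particular the set is stable
under `n₁ ↦ 2u(K+3) − n₁` and `n₂ ↦ 2u(K+3) − n₂`. -/
theorem statement1 (u : ℕ) (hu : 0 < u) (K : ℚ) :
    ((Padm u K).Nonempty ↔
      Odd u ∧ ∃ p : ℤ, (p : ℚ) = (u : ℚ) * (K + 3) ∧ 2 ≤ p ∧ Int.gcd (u : ℤ) p = 1) ∧
    (∀ p : ℤ, (p : ℚ) = (u : ℚ) * (K + 3) → 2 ≤ p → Int.gcd (u : ℤ) p = 1 → Odd u →
      (Padm u K =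
        {Λ | ∃ n₁ n₂ : ℤ, 0 < n₁ ∧ 0 < n₂ ∧ n₁ < 2 * p ∧ n₂ < 2 * p ∧
          Odd (n₁ - n₂) ∧ Λ = LamW K n₁ n₂}) ∧
      (∀ n₁ n₂ : ℤ, LamW K n₁ n₂ ∈ Padm u K →
        LamW K (2 * p - n₁) n₂ ∈ Padm u K ∧
        LamW K n₁ (2 * p - n₂) ∈ Padm u K ∧
        LamW K (2 * p - n₁) (2 * p - n₂) ∈ Padm u K)) := by
  have main : ∀ p : ℤ, (p : ℚ) = (u : ℚ) * (K + 3) → 2 ≤ p → Int.gcd (u : ℤ) p = 1 → Odd u →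
      (Padm u K =
        {Λ | ∃ n₁ n₂ : ℤ, 0 < n₁ ∧ 0 < n₂ ∧ n₁ < 2 * p ∧ n₂ < 2 * p ∧
          Odd (n₁ - n₂) ∧ Λ = LamW K n₁ n₂}) := by
    intro p hp h2 hg hou
    ext Λ
    constructor
    · intro h
      obtain ⟨-, p', hp', -, -, n₁, n₂, h⟩ := fwd u hu K Λ h
      have : p' = p := by exact_mod_cast hp'.trans hp.symm
      subst this
      exact ⟨n₁, n₂, h⟩
    · rintro ⟨n₁, n₂, p1, p2, p3, p4, ho, rfl⟩
      exact bwd u hu K p hp hg hou n₁ n₂ p1 p2 p3 p4 ho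
  refine ⟨⟨?_, ?_⟩, ?_⟩
  · rintro ⟨Λ, h⟩
    obtain ⟨ho, p, hp, h2, hg, -⟩ := fwd u hu K Λ h
    exact ⟨ho, p, hp, h2, hg⟩
  · rintro ⟨ho, p, hp, h2, hg⟩
    exact ⟨_, bwd u hu K p hp hg ho 1 2 (by omega) (by omega) (by omega) (by omega) (by decide)⟩
  · intro p hp h2 hg hou
    refine ⟨main p hp h2 hg hou, ?_⟩
    intro n₁ n₂ h
    rw [main p hp h2 hg hou] at h
    obtain ⟨a, b, p1, p2, p3, p4, ho, he⟩ := h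
    obtain ⟨rfl, rfl⟩ := LamW_inj _ _ _ _ _ he
    refine ⟨?_, ?_, ?_⟩ <;>
    exact bwd u hu K p hp hg hou _ _ (by omega) (by omega) (by omega) (by omega) (by grind)

end
end

section
/- For every even positive integer m, the sum Σ_{k=0}^{2m−1} e^{πi k(k+1)/m} equals 0; equivalently, Σ_{k=0}^{2m−1} e^{πi (k+1/2)²/m} = 0. -/
open Complex Real

theorem aux_sum (m : ℕ) (f : ℕ → ℂ) (h : ∀ k, f (m + k) = - f k) :
    ∑ k ∈ Finset.range (2 * m), f k = 0 := by
  rw [two_mul, Finset.sum_range_add]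
  simp [h]

theorem aux_exp (z : ℂ) (n : ℕ) :
    Complex.exp (z + ((π : ℂ) * I + n * (2 * π * I))) = - Complex.exp z := by
  rw [Complex.exp_add, Complex.exp_add, Complex.exp_pi_mul_I, Complex.exp_nat_mul_two_pi_mul_I]
  ring

/-- For every even positive integer `m`,
`Σ_{k=0}^{2m−1} e^{πi k(k+1)/m} = 0`; equivalently,
`Σ_{k=0}^{2m−1} e^{πi (k+1/2)²/m} = 0`. -/
theorem statement2 (m : ℕ) (hm : 0 < m) (hme : Even m) :
    (∑ k ∈ Finset.range (2 * m),
      Complex.exp ((π : ℂ) * I * (k : ℂ) * ((k : ℂ) + 1) / (m : ℂ))) = 0 ∧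
    (∑ k ∈ Finset.range (2 * m),
      Complex.exp ((π : ℂ) * I * ((k : ℂ) + 1 / 2) ^ 2 / (m : ℂ))) = 0 := by
  obtain ⟨r, rfl⟩ := hme
  have h0 : (r : ℂ) ≠ 0 := by
    have : r ≠ 0 := by omega
    exact_mod_cast this
  constructor
  · apply aux_sum
    intro k
    rw [← aux_exp _ (k + r)]
    congr 1
    push_cast
    field_simp
    ring
  · apply aux_sum
    intro k
    rw [← aux_exp _ (k + r)]
    congr 1
    push_cast
    field_simp
    ring
end

section
/- Let m be an even positive integer and n an integer. If n is odd then Σ_{k=0}^{2m−1} e^{πi k(k+n)/m} = 0, and if n is even then Σ_{k=0}^{2m−1} e^{πi k(k+n)/m} = e^{−πi n²/(4m)} γ_m, where γ_m := Σ_{k=0}^{2m−1} e^{πi k²/m}. -/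
open Complex Real

/-- The Gauss sum `γ_m := Σ_{k=0}^{2m−1} e^{πi k²/m}`. -/
noncomputable def gammaGauss (m : ℕ) : ℂ :=
  ∑ k ∈ Finset.range (2 * m), Complex.exp ((π : ℂ) * I * (k : ℂ) ^ 2 / (m : ℂ))

lemma shift_aux (N : ℕ) (g : ℤ → ℂ) (hg : ∀ j, g (j + N) = g j) (r : ℤ) :
    ∑ k ∈ Finset.range N, g (k + r) = ∑ k ∈ Finset.range N, g k := by
  have step : ∀ r : ℤ, ∑ k ∈ Finset.range N, g (k + (r + 1)) = ∑ k ∈ Finset.range N, g (k + r) := by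
    intro r
    have h1 := Finset.sum_range_succ (fun k : ℕ => g (k + r)) N
    have h2 := Finset.sum_range_succ' (fun k : ℕ => g (k + r)) N
    have h3 : g ((N : ℤ) + r) = g r := by rw [add_comm, hg]
    have h4 : ∀ k : ℕ, g (((k + 1 : ℕ) : ℤ) + r) = g (k + (r + 1)) := by
      intro k
      congr 1
      push_cast
      ring
    simp only [h4, h3, Nat.cast_zero, zero_add] at h1 h2
    exact add_right_cancel (h2.symm.trans h1)
  induction r using Int.induction_on with
  | zero => simp
  | succ i ih => rw [step, ih]
  | pred i ih =>
    have := step (-(i : ℤ) - 1)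
    rw [sub_add_cancel] at this
    rw [← this, ih]

/-- Let `m` be an even positive integer and `n` an integer.
If `n` is odd then `Σ_{k=0}^{2m−1} e^{πi k(k+n)/m} = 0`, and if `n` is even then
`Σ_{k=0}^{2m−1} e^{πi k(k+n)/m} = e^{−πi n²/(4m)} γ_m`. -/
theorem statement3 (m : ℕ) (hm : 0 < m) (hme : Even m) (n : ℤ) :
    (Odd n → ∑ k ∈ Finset.range (2 * m),
        Complex.exp ((π : ℂ) * I * (k : ℂ) * ((k : ℂ) + (n : ℂ)) / (m : ℂ)) = 0) ∧
    (Even n → ∑ k ∈ Finset.range (2 * m),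
        Complex.exp ((π : ℂ) * I * (k : ℂ) * ((k : ℂ) + (n : ℂ)) / (m : ℂ)) =
      Complex.exp (-(π : ℂ) * I * (n : ℂ) ^ 2 / (4 * (m : ℂ))) * gammaGauss m) := by
  have hm0 : (m : ℂ) ≠ 0 := by exact_mod_cast hm.ne'
  constructor
  · intro hn
    obtain ⟨a, ha⟩ := hme
    obtain ⟨b, hb⟩ := hn
    rw [two_mul, Finset.sum_range_add, ← Finset.sum_add_distrib]
    refine Finset.sum_eq_zero fun k _ => ?_
    have hA : (m : ℂ) = a + a := by rw [ha]; push_cast; ring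
    have hB : (n : ℂ) = 2 * b + 1 := by rw [hb]; push_cast; ring
    have e : (π : ℂ) * I * ((m + k : ℕ) : ℂ) * (((m + k : ℕ) : ℂ) + (n : ℂ)) / (m : ℂ)
        = (π : ℂ) * I * (k : ℂ) * ((k : ℂ) + (n : ℂ)) / (m : ℂ) + π * I
          + ((k + a + b : ℤ) : ℂ) * (2 * π * I) := by
      have : (π : ℂ) * I * ((m + k : ℕ) : ℂ) * (((m + k : ℕ) : ℂ) + (n : ℂ)) / (m : ℂ)
        = (π : ℂ) * I * (k : ℂ) * ((k : ℂ) + (n : ℂ)) / (m : ℂ) + π * I * (2 * k + m + n) := by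
        push_cast
        field_simp
        ring
      rw [this, add_assoc (_ / _)]
      congr 1
      rw [hA, hB]
      push_cast
      ring
    rw [e, Complex.exp_add, Complex.exp_int_mul_two_pi_mul_I, Complex.exp_add, Complex.exp_pi_mul_I]
    ring
  · rintro ⟨r, hr⟩
    have hR : (n : ℂ) = 2 * r := by rw [hr]; push_cast; ring
    have key := shift_aux (2 * m) (fun j : ℤ => Complex.exp ((π : ℂ) * I * (j : ℂ) ^ 2 / (m : ℂ)))
      (by
        intro j
        have e : (π : ℂ) * I * ((j + (2 * m : ℕ) : ℤ) : ℂ) ^ 2 / (m : ℂ)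
          = (π : ℂ) * I * (j : ℂ) ^ 2 / (m : ℂ) + ((2 * j + 2 * m : ℤ) : ℂ) * (2 * π * I) := by
          push_cast
          field_simp
          ring
        simp only [e]
        rw [Complex.exp_add, Complex.exp_int_mul_two_pi_mul_I, mul_one]) r
    simp only [Int.cast_natCast] at key
    rw [gammaGauss, ← key, Finset.mul_sum]
    refine Finset.sum_congr rfl fun k _ => ?_
    rw [← Complex.exp_add]
    congr 1
    rw [hR]
    push_cast
    field_simp
    ring
end

section
/- For all a, b ∈ {0,1}, every τ ∈ ℍ and every z ∈ ℂ: (2τ−1)^{−1/2} · e^{−2πi z²/(2τ−1)} · ϑ_{ab}( −τ/(2τ−1), z/(2τ−1) ) = −i^{b+1}(−1)^{ab} · ϑ_{ab}(τ,z). Explicitly, the multiplier is −i for (a,b)=(0,0), +1 for (a,b)=(0,1), −i for (a,b)=(1,0), and −1 for (a,b)=(1,1). -/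
noncomputable section

open Complex Real UpperHalfPlane

/-- Mumford's theta function
`ϑ_{ab}(τ,z) := q^{a/8} e^{−aπi(z+b/2)}
  ∏_{n=1}^∞ (1−q^n)(1+(−1)^b e^{2πiz} q^{n−(a+1)/2})(1+(−1)^b e^{−2πiz} q^{n+(a−1)/2})`,
where `q = e^{2πiτ}` and `q^s := e^{2πiτs}`. -/
def mumTh (a b : ℕ) (τ z : ℂ) : ℂ :=
  Complex.exp (2 * (π : ℂ) * Complex.I * τ * ((a : ℂ) / 8)) *
  Complex.exp (-(a : ℂ) * (π : ℂ) * Complex.I * (z + (b : ℂ) / 2)) *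
  ∏' n : ℕ,
    ((1 - Complex.exp (2 * (π : ℂ) * Complex.I * τ * ((n : ℂ) + 1))) *
     (1 + (-1 : ℂ) ^ b * Complex.exp (2 * (π : ℂ) * Complex.I * z) *
        Complex.exp (2 * (π : ℂ) * Complex.I * τ * ((n : ℂ) + 1 - ((a : ℂ) + 1) / 2))) *
     (1 + (-1 : ℂ) ^ b * Complex.exp (-(2 * (π : ℂ) * Complex.I * z)) *
        Complex.exp (2 * (π : ℂ) * Complex.I * τ * ((n : ℂ) + 1 + ((a : ℂ) - 1) / 2))))

open Filter Topology

def qp (r : ℂ) (m : ℕ) : ℂ := ∏ k ∈ Finset.range m, (1 - r ^ (2 * (k + 1)))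

def invp (r : ℂ) (m : ℤ) : ℂ := if m < 0 then 0 else (qp r m.toNat)⁻¹

lemma qfac_ne {r : ℂ} (hr : ‖r‖ < 1) (k : ℕ) : 1 - r ^ (2 * (k + 1)) ≠ 0 := by
  intro h
  have h1 : r ^ (2 * (k + 1)) = 1 := (sub_eq_zero.mp h).symm
  have h2 : ‖r‖ ^ (2 * (k + 1)) < 1 := pow_lt_one₀ (norm_nonneg _) hr (by omega)
  rw [← norm_pow, h1] at h2
  simp at h2

lemma qp_ne {r : ℂ} (hr : ‖r‖ < 1) (m : ℕ) : qp r m ≠ 0 :=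
  Finset.prod_ne_zero_iff.mpr fun k _ => qfac_ne hr k

lemma invp_rec {r : ℂ} (hr : ‖r‖ < 1) (m : ℤ) :
    invp r (m - 1) = (1 - r ^ (2 * m)) * invp r m := by
  unfold invp
  rcases lt_trichotomy m 0 with h | h | h
  · rw [if_pos (by omega), if_pos h]; simp
  · subst h; simp
  · rw [if_neg (by omega), if_neg (by omega)]
    obtain ⟨k, rfl⟩ : ∃ k : ℕ, m = (k : ℤ) + 1 := ⟨(m - 1).toNat, by omega⟩
    have e1 : ((k : ℤ) + 1 - 1).toNat = k := by omega
    have e2 : ((k : ℤ) + 1).toNat = k + 1 := by omega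
    rw [e1, e2, qp, qp, Finset.prod_range_succ]
    have e3 : r ^ (2 * ((k : ℤ) + 1)) = r ^ (2 * (k + 1)) := by
      rw [← zpow_natCast]; push_cast; rfl
    rw [e3]
    have := qfac_ne hr k
    have h2 := qp_ne hr k
    unfold qp at h2
    field_simp

def cc (r : ℂ) (N : ℕ) (n : ℤ) : ℂ := qp r (2 * N) * invp r (N + n) * invp r (N - n)

lemma cc_rec {r : ℂ} (hr0 : r ≠ 0) (hr : ‖r‖ < 1) (N : ℕ) (n : ℤ) :
    cc r (N + 1) n = (1 + r ^ (4 * N + 2)) * cc r N n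
      + r ^ (2 * ((N : ℤ) + 1 - n)) * cc r N (n - 1)
      + r ^ (2 * ((N : ℤ) + 1 + n)) * cc r N (n + 1) := by
  unfold cc
  have a1 := invp_rec hr ((N : ℤ) + 1 + n)
  have a2 := invp_rec hr ((N : ℤ) + n)
  have b1 := invp_rec hr ((N : ℤ) + 1 - n)
  have b2 := invp_rec hr ((N : ℤ) - n)
  rw [show (N : ℤ) + 1 + n - 1 = N + n by ring] at a1
  rw [show (N : ℤ) + 1 - n - 1 = N - n by ring] at b1
  push_cast
  rw [show (N : ℤ) + (n - 1) = N + n - 1 by ring, show (N : ℤ) - (n - 1) = N + 1 - n by ring,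
    show (N : ℤ) - (n + 1) = N - n - 1 by ring, show (N : ℤ) + (n + 1) = N + 1 + n by ring,
    a2, b2, a1, b1]
  have hq : qp r (2 * (N + 1)) = qp r (2 * N) * (1 - r ^ (4 * N + 2)) * (1 - r ^ (4 * N + 4)) := by
    rw [show 2 * (N + 1) = 2 * N + 1 + 1 by ring]
    unfold qp
    rw [Finset.prod_range_succ, Finset.prod_range_succ]
    ring_nf
  rw [hq]
  set u := r ^ (2 * ((N : ℤ) + 1 + n)) with hu
  set v := r ^ (2 * ((N : ℤ) + 1 - n)) with hv
  have hu' : r ^ (2 * ((N : ℤ) + n)) = u / r ^ 2 := by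
    rw [hu, show 2 * ((N : ℤ) + 1 + n) = 2 * ((N : ℤ) + n) + 2 by ring, zpow_add₀ hr0]
    field_simp
  have hv' : r ^ (2 * ((N : ℤ) - n)) = v / r ^ 2 := by
    rw [hv, show 2 * ((N : ℤ) + 1 - n) = 2 * ((N : ℤ) - n) + 2 by ring, zpow_add₀ hr0]
    field_simp
  have huv : r ^ (4 * N + 4) = u * v := by
    rw [hu, hv, ← zpow_add₀ hr0, ← zpow_natCast]; push_cast; congr 1; ring
  have huv' : r ^ (4 * N + 2) = u * v / r ^ 2 := by
    rw [← huv]; field_simp; ring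
  rw [hu', hv', huv, huv']
  field_simp
  ring

def pp (r x : ℂ) (N : ℕ) : ℂ :=
  ∏ k ∈ Finset.range N, ((1 + x * r ^ (2 * k + 1)) * (1 + x⁻¹ * r ^ (2 * k + 1)))

lemma hasSum_pp {r x : ℂ} (hr0 : r ≠ 0) (hr : ‖r‖ < 1) (hx : x ≠ 0) (N : ℕ) :
    HasSum (fun n : ℤ => cc r N n * (r ^ (n ^ 2) * x ^ n)) (pp r x N) := by
  induction N with
  | zero =>
    have h := hasSum_single (f := fun n : ℤ => cc r 0 n * (r ^ (n ^ 2) * x ^ n)) 0 (by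
      intro n hn
      rcases lt_or_gt_of_ne hn with h | h
      · simp [cc, invp, h]
      · simp [cc, invp, h])
    simpa [cc, invp, pp, qp] using h
  | succ N ih =>
    have h1 := (Equiv.subRight (1 : ℤ)).hasSum_iff.mpr ih
    have h2 := (Equiv.addRight (1 : ℤ)).hasSum_iff.mpr ih
    have h := ((ih.mul_left (1 + r ^ (4 * N + 2))).add (h1.mul_left (x * r ^ (2 * N + 1)))).add
      (h2.mul_left (x⁻¹ * r ^ (2 * N + 1)))
    convert h using 1
    · rfl
    · funext n
      simp only [Function.comp, Equiv.subRight_apply, Equiv.coe_addRight]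
      rw [cc_rec hr0 hr]
      have e1 : r ^ (2 * ((N : ℤ) + 1 - n)) * (r ^ (n ^ 2) * x ^ n)
          = x * r ^ (2 * N + 1) * (r ^ ((n - 1) ^ 2) * x ^ (n - 1)) := by
        rw [zpow_sub_one₀ hx, ← zpow_natCast r (2 * N + 1)]
        have : r ^ (2 * ((N : ℤ) + 1 - n)) * r ^ (n ^ 2)
          = r ^ ((2 * N + 1 : ℕ) : ℤ) * r ^ ((n - 1) ^ 2) := by
          rw [← zpow_add₀ hr0, ← zpow_add₀ hr0]; congr 1; push_cast; ring
        rw [← mul_assoc, this]; field_simp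
      have e2 : r ^ (2 * ((N : ℤ) + 1 + n)) * (r ^ (n ^ 2) * x ^ n)
          = x⁻¹ * r ^ (2 * N + 1) * (r ^ ((n + 1) ^ 2) * x ^ (n + 1)) := by
        rw [zpow_add_one₀ hx, ← zpow_natCast r (2 * N + 1)]
        have : r ^ (2 * ((N : ℤ) + 1 + n)) * r ^ (n ^ 2)
          = r ^ ((2 * N + 1 : ℕ) : ℤ) * r ^ ((n + 1) ^ 2) := by
          rw [← zpow_add₀ hr0, ← zpow_add₀ hr0]; congr 1; push_cast; ring
        rw [← mul_assoc, this]; field_simp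
      linear_combination cc r N (n - 1) * e1 + cc r N (n + 1) * e2
    · unfold pp
      rw [Finset.prod_range_succ]
      have : x * x⁻¹ = 1 := mul_inv_cancel₀ hx
      linear_combination (∏ k ∈ Finset.range N, ((1 + x * r ^ (2 * k + 1)) * (1 + x⁻¹ * r ^ (2 * k + 1)))) * r ^ (4 * N + 2) * this

lemma qp_tendsto {r : ℂ} (hr : ‖r‖ < 1) :
    ∃ L : ℂ, L ≠ 0 ∧ Tendsto (qp r) atTop (𝓝 L) := by
  have hs : Summable fun k : ℕ => ‖-r ^ (2 * (k + 1))‖ := by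
    have : ‖r‖ ^ 2 < 1 := pow_lt_one₀ (norm_nonneg _) hr (by omega)
    simpa [pow_mul] using (summable_nat_add_iff 1).mpr (summable_geometric_of_lt_one (by positivity) this)
  have hm := multipliable_one_add_of_summable hs
  refine ⟨∏' k : ℕ, (1 + -r ^ (2 * (k + 1))), ?_, ?_⟩
  · apply tprod_one_add_ne_zero_of_summable _ hs
    intro k
    simpa [sub_eq_add_neg] using qfac_ne hr k
  · have := hm.hasProd.tendsto_prod_nat
    simp only [← sub_eq_add_neg] at this ⊢
    exact this

lemma jtp {r x : ℂ} (hr0 : r ≠ 0) (hr : ‖r‖ < 1) (hx : x ≠ 0)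
    (hs : Summable fun n : ℤ => r ^ (n ^ 2) * x ^ n) :
    ∏' n : ℕ, ((1 - r ^ (2 * (n + 1))) * (1 + x * r ^ (2 * n + 1)) * (1 + x⁻¹ * r ^ (2 * n + 1)))
      = ∑' n : ℤ, r ^ (n ^ 2) * x ^ n := by
  obtain ⟨L, hL, hqL⟩ := qp_tendsto hr
  have hsum (y : ℂ) : Summable fun k : ℕ => ‖y * r ^ (2 * k + 1)‖ := by
    have : ‖r‖ ^ 2 < 1 := pow_lt_one₀ (norm_nonneg _) hr (by omega)
    have := ((summable_geometric_of_lt_one (by positivity) this).mul_left ‖y‖).mul_right ‖r‖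
    simpa [pow_succ, pow_mul, mul_assoc] using this
  have hs0 : Summable fun k : ℕ => ‖-r ^ (2 * (k + 1))‖ := by
    have : ‖r‖ ^ 2 < 1 := pow_lt_one₀ (norm_nonneg _) hr (by omega)
    simpa [pow_mul] using (summable_nat_add_iff 1).mpr (summable_geometric_of_lt_one (by positivity) this)
  have hmul := ((multipliable_one_add_of_summable hs0).mul
    (multipliable_one_add_of_summable (hsum x))).mul (multipliable_one_add_of_summable (hsum x⁻¹))
  simp only [← sub_eq_add_neg] at hmul
  have ht1 := hmul.hasProd.tendsto_prod_nat
  have hN : ∀ N : ℕ, ∏ n ∈ Finset.range N, ((1 - r ^ (2 * (n + 1))) * (1 + x * r ^ (2 * n + 1))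
      * (1 + x⁻¹ * r ^ (2 * n + 1))) = qp r N * pp r x N := by
    intro N
    rw [qp, pp, ← Finset.prod_mul_distrib]
    exact Finset.prod_congr rfl fun k _ => by ring
  simp only [hN] at ht1
  -- limit of pp
  have hinv : Tendsto (fun m : ℕ => (qp r m)⁻¹) atTop (𝓝 L⁻¹) := hqL.inv₀ hL
  have hcast : Tendsto (fun m : ℤ => invp r m) atTop (𝓝 L⁻¹) := by
    have h3 : Tendsto (fun m : ℤ => (qp r m.toNat)⁻¹) atTop (𝓝 L⁻¹) :=
      hinv.comp (tendsto_atTop.mpr fun b => by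
        filter_upwards [eventually_ge_atTop (b : ℤ)] with m hm
        omega)
    refine h3.congr' ?_
    filter_upwards [eventually_ge_atTop (0 : ℤ)] with m hm
    rw [invp, if_neg (by omega)]
  obtain ⟨B, hB⟩ := hqL.norm.bddAbove_range
  obtain ⟨C, hC⟩ := hinv.norm.bddAbove_range
  have hB' : ∀ m, ‖qp r m‖ ≤ B := fun m => hB ⟨m, rfl⟩
  have hC' : ∀ m, ‖(qp r m)⁻¹‖ ≤ C := fun m => hC ⟨m, rfl⟩
  have hC0 : 0 ≤ C := (norm_nonneg _).trans (hC' 0)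
  have hB0 : 0 ≤ B := (norm_nonneg _).trans (hB' 0)
  have hC2 : ∀ m, ‖invp r m‖ ≤ C := by
    intro m
    unfold invp
    split_ifs
    · simpa using hC0
    · exact hC' _
  have hlim : Tendsto (fun N : ℕ => ∑' n : ℤ, cc r N n * (r ^ (n ^ 2) * x ^ n)) atTop
      (𝓝 (∑' n : ℤ, L⁻¹ * (r ^ (n ^ 2) * x ^ n))) := by
    apply tendsto_tsum_of_dominated_convergence (hs.norm.mul_left (B * C * C))
    · intro n
      apply Tendsto.mul_const
      have hNz : Tendsto (fun N : ℕ => (N : ℤ)) atTop atTop := tendsto_natCast_atTop_atTop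
      have t1 : Tendsto (fun N : ℕ => invp r ((N : ℤ) + n)) atTop (𝓝 L⁻¹) :=
        hcast.comp (tendsto_atTop_add_const_right _ n hNz)
      have t2 : Tendsto (fun N : ℕ => invp r ((N : ℤ) - n)) atTop (𝓝 L⁻¹) :=
        hcast.comp (tendsto_atTop_add_const_right _ (-n) hNz)
      have t0 : Tendsto (fun N : ℕ => qp r (2 * N)) atTop (𝓝 L) :=
        hqL.comp (tendsto_id.const_mul_atTop' (by norm_num))
      have := (t0.mul t1).mul t2
      rw [mul_inv_cancel₀ hL, one_mul] at this
      exact this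
    · refine Eventually.of_forall fun N n => ?_
      rw [norm_mul]
      refine mul_le_mul_of_nonneg_right ?_ (norm_nonneg _)
      rw [cc, norm_mul, norm_mul]
      gcongr
      · exact hB' _
      · exact hC2 _
      · exact hC2 _
  have hlim2 := hqL.mul hlim
  simp only [fun N => (hasSum_pp hr0 hr hx N).tsum_eq] at hlim2
  rw [tendsto_nhds_unique ht1 hlim2, tsum_mul_left, ← mul_assoc, mul_inv_cancel₀ hL, one_mul]

lemma mumTh_eq (a b : ℕ) (τ z : ℂ) (hτ : 0 < τ.im) :
    mumTh a b τ z = Complex.exp (2 * (π : ℂ) * Complex.I * τ * ((a : ℂ) / 8)) *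
      Complex.exp (-(a : ℂ) * (π : ℂ) * Complex.I * (z + (b : ℂ) / 2)) *
      jacobiTheta₂ (z + b / 2 - a * τ / 2) τ := by
  unfold mumTh
  congr 1
  have hr : ‖Complex.exp (π * Complex.I * τ)‖ < 1 := by
    rw [Complex.norm_exp]
    simp only [Real.exp_lt_one_iff]
    simp
    positivity
  have hterm : ∀ n : ℤ, Complex.exp (π * Complex.I * τ) ^ (n ^ 2) *
      Complex.exp (2 * π * Complex.I * (z + b / 2 - a * τ / 2)) ^ n
      = jacobiTheta₂_term n (z + b / 2 - a * τ / 2) τ := by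
    intro n
    rw [jacobiTheta₂_term, ← Complex.exp_int_mul, ← Complex.exp_int_mul, ← Complex.exp_add]
    congr 1; push_cast; ring
  have hb : (-1 : ℂ) ^ b = Complex.exp (b * (π * Complex.I)) := by
    rw [Complex.exp_nat_mul, Complex.exp_pi_mul_I]
  have hb' : (-1 : ℂ) ^ b = Complex.exp (-(b * (π * Complex.I))) := by
    rw [Complex.exp_neg, Complex.exp_nat_mul, Complex.exp_pi_mul_I, ← inv_pow]; norm_num
  have h := jtp (Complex.exp_ne_zero (π * Complex.I * τ)) hr
    (Complex.exp_ne_zero (2 * π * Complex.I * (z + b / 2 - a * τ / 2)))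
    (by
      simp only [hterm]
      exact (summable_jacobiTheta₂_term_iff _ _).mpr hτ)
  simp only [hterm] at h
  rw [jacobiTheta₂, ← h]
  refine tprod_congr fun n => ?_
  congr 1
  · congr 1
    · congr 1
      rw [← Complex.exp_nat_mul]
      congr 1; push_cast; ring
    · congr 1
      rw [hb, ← Complex.exp_nat_mul, ← Complex.exp_add, ← Complex.exp_add, ← Complex.exp_add]
      congr 1; push_cast; ring
  · congr 1
    rw [hb', ← Complex.exp_nat_mul, ← Complex.exp_neg, ← Complex.exp_add, ← Complex.exp_add,
      ← Complex.exp_add]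
    congr 1; push_cast; ring

lemma sqrt_aux (τ : ℂ) (hτ : 0 < τ.im) (hτ' : 0 < (-τ / (2 * τ - 1)).im) :
    (2 * τ - 1) ^ (1 / 2 : ℂ) * (-Complex.I * (-τ / (2 * τ - 1))) ^ (1 / 2 : ℂ)
      = Complex.I * (-Complex.I * τ) ^ (1 / 2 : ℂ) := by
  have h0 : τ ≠ 0 := by rintro rfl; simp at hτ
  have hT : (2 * τ - 1) ≠ 0 := by
    intro h; rw [h] at hτ'; simp at hτ'
  have hTim : 0 < (2 * τ - 1).im := by simpa using hτ
  set T := 2 * τ - 1 with hTdef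
  set s := -τ / T with hs
  have hs0 : s ≠ 0 := by intro h; rw [h] at hτ'; simp at hτ'
  have hIs : -Complex.I * s ≠ 0 := mul_ne_zero (neg_ne_zero.mpr Complex.I_ne_zero) hs0
  have hIt : -Complex.I * τ ≠ 0 := mul_ne_zero (neg_ne_zero.mpr Complex.I_ne_zero) h0
  have key : Complex.exp (Complex.log T + Complex.log (-Complex.I * s)
      - Complex.log (-Complex.I * τ)) = Complex.exp (π * Complex.I) := by
    rw [Complex.exp_sub, Complex.exp_add, Complex.exp_log hT, Complex.exp_log hIs,
      Complex.exp_log hIt, Complex.exp_pi_mul_I, hs]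
    field_simp
  obtain ⟨k, hk⟩ := Complex.exp_eq_exp_iff_exists_int.mp key
  have g1 : 0 ≤ (Complex.log T).im := by
    rw [Complex.log_im]; exact Complex.arg_nonneg_iff.mpr hTim.le
  have g1' : (Complex.log T).im ≤ π := by rw [Complex.log_im]; exact Complex.arg_le_pi _
  have g2 := Complex.abs_arg_lt_pi_div_two_iff.mpr
    (Or.inl (show 0 < (-Complex.I * s).re by simpa using hτ'))
  have g3 := Complex.abs_arg_lt_pi_div_two_iff.mpr
    (Or.inl (show 0 < (-Complex.I * τ).re by simpa using hτ))
  rw [← Complex.log_im, abs_lt] at g2 g3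
  have him := congrArg Complex.im hk
  rw [Complex.sub_im, Complex.add_im] at him
  have e : (π * Complex.I + k * (2 * π * Complex.I) : ℂ).im = π + k * (2 * π) := by
    simp
  rw [e] at him
  have hpi := Real.pi_pos
  have k1 : (k : ℝ) < 1 := by
    by_contra hc; push Not at hc; nlinarith
  have k2 : (-1 : ℝ) < k := by
    by_contra hc; push Not at hc; nlinarith
  have hk0 : k = 0 := by
    have : k < 1 := by exact_mod_cast k1
    have : -1 < k := by exact_mod_cast k2
    omega
  rw [hk0] at hk
  rw [Complex.cpow_def_of_ne_zero hT, Complex.cpow_def_of_ne_zero hIs,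
    Complex.cpow_def_of_ne_zero hIt, ← Complex.exp_add]
  generalize Complex.log (-Complex.I * τ) = l at *
  conv_rhs => rw [← Complex.exp_pi_div_two_mul_I, ← Complex.exp_add]
  congr 1
  push_cast at hk
  linear_combination hk / 2

lemma theta_aux (a b : ℕ) (ha : a = 0 ∨ a = 1) (hb : b = 0 ∨ b = 1) (v σ : ℂ) :
    jacobiTheta₂ (-(v + b * σ + a + b)) (σ + 2)
      = Complex.exp (-π * Complex.I * (b * (σ + 2 * v))) * jacobiTheta₂ v σ := by
  rw [jacobiTheta₂_neg_left, jacobiTheta₂_add_right]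
  rcases ha with rfl | rfl <;> rcases hb with rfl | rfl <;>
    simp [jacobiTheta₂_add_left, jacobiTheta₂_add_left']

/-- For `a, b ∈ {0,1}`, `τ ∈ ℍ`, `z ∈ ℂ`:
`(2τ−1)^{−1/2} e^{−2πiz²/(2τ−1)} ϑ_{ab}(−τ/(2τ−1), z/(2τ−1)) = −i^{b+1}(−1)^{ab} ϑ_{ab}(τ,z)`. -/
theorem statement5 (a b : ℕ) (ha : a = 0 ∨ a = 1) (hb : b = 0 ∨ b = 1)
    (τ : ℍ) (z : ℂ) :
    (2 * (τ : ℂ) - 1) ^ (-(1 / 2) : ℂ) *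
      Complex.exp (-2 * (π : ℂ) * Complex.I * z ^ 2 / (2 * (τ : ℂ) - 1)) *
      mumTh a b (-(τ : ℂ) / (2 * (τ : ℂ) - 1)) (z / (2 * (τ : ℂ) - 1)) =
    -(Complex.I ^ (b + 1) * (-1 : ℂ) ^ (a * b)) * mumTh a b τ z := by
  have hτ : 0 < (τ : ℂ).im := τ.im_pos
  generalize (τ : ℂ) = t at hτ
  have h0 : t ≠ 0 := by rintro rfl; simp at hτ
  have hT : (2 * t - 1) ≠ 0 := by
    intro h
    have := congrArg Complex.im h
    simp at this
    exact hτ.ne' this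
  have hτ' : 0 < (-t / (2 * t - 1)).im := by
    have e : (-t / (2 * t - 1)).im = t.im / Complex.normSq (2 * t - 1) := by
      rw [Complex.div_im]
      have := (Complex.normSq_pos.mpr hT).ne'
      simp
      field_simp
      ring
    rw [e]
    exact div_pos hτ (Complex.normSq_pos.mpr hT)
  have hsq := sqrt_aux t hτ hτ'
  rw [mumTh_eq a b _ _ hτ, mumTh_eq a b _ _ hτ', jacobiTheta₂_functional_equation _ t,
    jacobiTheta₂_functional_equation _ (-t / (2 * t - 1))]
  have hs0 : -t / (2 * t - 1) ≠ 0 := div_ne_zero (neg_ne_zero.mpr h0) hT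
  have e1 : -1 / (-t / (2 * t - 1)) = -1 / t + 2 := by field_simp; ring
  have e2 : (z / (2 * t - 1) + b / 2 - a * (-t / (2 * t - 1)) / 2) / (-t / (2 * t - 1))
      = -((z + b / 2 - a * t / 2) / t + b * (-1 / t) + a + b) := by
    field_simp; ring
  rw [e1, e2, theta_aux a b ha hb, Complex.cpow_neg]
  have hA : (2 * t - 1) ^ (1 / 2 : ℂ) ≠ 0 := by simp [Complex.cpow_eq_zero_iff, hT]
  have hB : (-Complex.I * (-t / (2 * t - 1))) ^ (1 / 2 : ℂ) ≠ 0 := by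
    rw [Ne, Complex.cpow_eq_zero_iff]
    exact fun h => mul_ne_zero (neg_ne_zero.mpr Complex.I_ne_zero) hs0 h.1
  have hC : (-Complex.I * t) ^ (1 / 2 : ℂ) ≠ 0 := by
    rw [Ne, Complex.cpow_eq_zero_iff]
    exact fun h => mul_ne_zero (neg_ne_zero.mpr Complex.I_ne_zero) h0 h.1
  have hfac : ((2 * t - 1) ^ (1 / 2 : ℂ))⁻¹ * (1 / (-Complex.I * (-t / (2 * t - 1))) ^ (1 / 2 : ℂ))
      = -Complex.I * (1 / (-Complex.I * t) ^ (1 / 2 : ℂ)) := by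
    rw [one_div ((-Complex.I * (-t / (2 * t - 1))) ^ (1 / 2 : ℂ)), ← mul_inv, hsq, mul_inv,
      Complex.inv_I, one_div ((-Complex.I * t) ^ (1 / 2 : ℂ))]
  have hI : Complex.I ^ b * (-1 : ℂ) ^ (a * b)
      = Complex.exp (π * Complex.I * (b / 2 + a * b)) := by
    rw [mul_add, Complex.exp_add]
    congr 1
    · conv_lhs => rw [← Complex.exp_pi_div_two_mul_I, ← Complex.exp_nat_mul]
      congr 1; ring
    · rw [← Complex.exp_pi_mul_I, ← Complex.exp_nat_mul]; congr 1; push_cast; ring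
  have hexp : Complex.exp (-2 * π * Complex.I * z ^ 2 / (2 * t - 1)) *
      Complex.exp (2 * π * Complex.I * (-t / (2 * t - 1)) * (a / 8)) *
      Complex.exp (-a * π * Complex.I * (z / (2 * t - 1) + b / 2)) *
      Complex.exp (-π * Complex.I * (z / (2 * t - 1) + b / 2 - a * (-t / (2 * t - 1)) / 2) ^ 2
        / (-t / (2 * t - 1))) *
      Complex.exp (-π * Complex.I * (b * (-1 / t + 2 * ((z + b / 2 - a * t / 2) / t))))
      = Complex.I ^ b * (-1 : ℂ) ^ (a * b) *
      (Complex.exp (2 * π * Complex.I * t * (a / 8)) *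
      Complex.exp (-a * π * Complex.I * (z + b / 2)) *
      Complex.exp (-π * Complex.I * (z + b / 2 - a * t / 2) ^ 2 / t)) := by
    rw [hI]
    simp only [← Complex.exp_add]
    congr 1
    rcases ha with rfl | rfl <;> rcases hb with rfl | rfl <;> push_cast <;> field_simp <;> ring
  generalize jacobiTheta₂ ((z + b / 2 - a * t / 2) / t) (-1 / t) = J
  rw [pow_succ Complex.I b]
  linear_combination (-Complex.I * (1 / (-Complex.I * t) ^ (1 / 2 : ℂ)) * J) * hexp
   + (Complex.exp (-2 * π * Complex.I * z ^ 2 / (2 * t - 1)) *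
      Complex.exp (2 * π * Complex.I * (-t / (2 * t - 1)) * (a / 8)) *
      Complex.exp (-a * π * Complex.I * (z / (2 * t - 1) + b / 2)) *
      Complex.exp (-π * Complex.I * (z / (2 * t - 1) + b / 2 - a * (-t / (2 * t - 1)) / 2) ^ 2
        / (-t / (2 * t - 1))) *
      Complex.exp (-π * Complex.I * (b * (-1 / t + 2 * ((z + b / 2 - a * t / 2) / t)))) * J) * hfac

end
end

section
/- For every τ ∈ ℍ and all z₁, z₂, t ∈ ℂ: τ^{−1} · R( −1/τ, z₁/τ, z₂/τ, t − (z₁²+z₂²)/(2τ) ) = −i · R(τ, z₁, z₂, t). -/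
noncomputable section

open Complex Real UpperHalfPlane

/-- `ϑ₁₁(τ,z) := q^{1/8} e^{−πi(z+1/2)} ∏_{n=1}^∞ (1−q^n)(1−e^{2πiz}q^{n−1})(1−e^{−2πiz}q^n)`,
where `q = e^{2πiτ}`. -/
def th11 (τ z : ℂ) : ℂ :=
  Complex.exp (2 * (π : ℂ) * Complex.I * τ / 8) *
  Complex.exp (-(π : ℂ) * Complex.I * (z + 1 / 2)) *
  ∏' n : ℕ,
    ((1 - Complex.exp (2 * (π : ℂ) * Complex.I * τ * ((n : ℂ) + 1))) *
     (1 - Complex.exp (2 * (π : ℂ) * Complex.I * z) *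
        Complex.exp (2 * (π : ℂ) * Complex.I * τ * (n : ℂ))) *
     (1 - Complex.exp (-(2 * (π : ℂ) * Complex.I * z)) *
        Complex.exp (2 * (π : ℂ) * Complex.I * τ * ((n : ℂ) + 1))))

/-- The Dedekind eta function `η(τ) := q^{1/24} ∏_{n=1}^∞ (1−q^n)`, `q = e^{2πiτ}`. -/
def dedekindEta (τ : ℂ) : ℂ :=
  Complex.exp (2 * (π : ℂ) * Complex.I * τ / 24) *
  ∏' n : ℕ, (1 - Complex.exp (2 * (π : ℂ) * Complex.I * τ * ((n : ℂ) + 1)))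

/-- The `C₂⁽¹⁾` Weyl–Kac denominator
`R(τ,z₁,z₂,t) := e^{6πit} η(τ)^{−2} ϑ₁₁(τ,z₁) ϑ₁₁(τ,z₂) ϑ₁₁(τ,z₁−z₂) ϑ₁₁(τ,z₁+z₂)`. -/
def Rden (τ z₁ z₂ t : ℂ) : ℂ :=
  Complex.exp (6 * (π : ℂ) * Complex.I * t) * (dedekindEta τ) ^ (-2 : ℤ) *
    th11 τ z₁ * th11 τ z₂ * th11 τ (z₁ - z₂) * th11 τ (z₁ + z₂)

lemma liou (τ : ℍ) (A B : ℂ → ℂ) (hA : Differentiable ℂ A) (hB : Differentiable ℂ B)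
    (hA0 : A 0 = 0) (hB0 : B 0 = 0) (hB' : deriv B 0 ≠ 0)
    (hz : ∀ z, B z = 0 → ∃ m n : ℤ, z = m + n * (τ : ℂ))
    (h1 : ∀ z, ∃ u : ℂ, u ≠ 0 ∧ A (z + 1) = u * A z ∧ B (z + 1) = u * B z)
    (h2 : ∀ z, ∃ u : ℂ, u ≠ 0 ∧ A (z + τ) = u * A z ∧ B (z + τ) = u * B z) (z : ℂ) :
    A z * deriv B 0 = deriv A 0 * B z := by
  classical
  set c : ℂ := deriv A 0 / deriv B 0 with hc
  set g : ℂ → ℂ := fun z => if B z = 0 then c else A z / B z with hg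
  have p1 : Function.Periodic g 1 := by
    intro z
    obtain ⟨u, hu, ha, hb⟩ := h1 z
    simp only [hg, ha, hb, mul_eq_zero, hu, false_or]
    rw [mul_div_mul_left _ _ hu]
  have p2 : Function.Periodic g (τ : ℂ) := by
    intro z
    obtain ⟨u, hu, ha, hb⟩ := h2 z
    simp only [hg, ha, hb, mul_eq_zero, hu, false_or]
    rw [mul_div_mul_left _ _ hu]
  have p3 : ∀ (m n : ℤ) z, g (z - (m + n * (τ : ℂ))) = g z := by
    intro m n z
    have a := (p1.int_mul m).sub_eq z
    have b := (p2.int_mul n).sub_eq (z - m * 1)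
    rw [← a, ← b]
    congr 1; ring
  have dA : Differentiable ℂ (dslope A 0) := by
    intro x
    have := (Complex.differentiableOn_dslope (f := A) (c := 0) (s := Set.univ) Filter.univ_mem).2
      hA.differentiableOn
    exact (this x trivial).differentiableAt Filter.univ_mem
  have dB : Differentiable ℂ (dslope B 0) := by
    intro x
    have := (Complex.differentiableOn_dslope (f := B) (c := 0) (s := Set.univ) Filter.univ_mem).2
      hB.differentiableOn
    exact (this x trivial).differentiableAt Filter.univ_mem
  have eA : ∀ z, A z = z * dslope A 0 z := by
    intro z
    have := sub_smul_dslope A 0 z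
    simpa [hA0] using this.symm
  have eB : ∀ z, B z = z * dslope B 0 z := by
    intro z
    have := sub_smul_dslope B 0 z
    simpa [hB0] using this.symm
  have g0 : DifferentiableAt ℂ g 0 := by
    have hne : dslope B 0 0 ≠ 0 := by simpa using hB'
    have hd : DifferentiableAt ℂ (fun z => dslope A 0 z / dslope B 0 z) 0 :=
      (dA 0).div (dB 0) hne
    refine hd.congr_of_eventuallyEq ?_
    filter_upwards [(dB 0).continuousAt.eventually_ne hne] with w hw
    by_cases h0 : w = 0
    · subst h0
      simp [hg, hB0, hc]
    · have : B w ≠ 0 := by rw [eB]; exact mul_ne_zero h0 hw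
      simp only [hg, if_neg this]
      rw [eA, eB, mul_div_mul_left _ _ h0]
  have gd : Differentiable ℂ g := by
    intro w
    by_cases h0 : B w = 0
    · obtain ⟨m, n, rfl⟩ := hz w h0
      have e : g = g ∘ (fun z => z - (m + n * (τ : ℂ))) := by
        funext z; exact (p3 m n z).symm
      rw [e]
      apply DifferentiableAt.comp
      · simpa using g0
      · fun_prop
    · refine ((hA w).div (hB w) h0).congr_of_eventuallyEq ?_
      filter_upwards [(hB w).continuousAt.eventually_ne h0] with v hv
      simp [hg, hv]
  have gb : Bornology.IsBounded (Set.range g) := by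
    have hK : IsCompact (g '' Metric.closedBall 0 (1 + τ.im)) :=
      (isCompact_closedBall _ _).image gd.continuous
    refine hK.isBounded.subset ?_
    rintro _ ⟨w, rfl⟩
    set n : ℤ := ⌊w.im / τ.im⌋
    set m : ℤ := ⌊(w - n * (τ : ℂ)).re⌋
    refine ⟨w - (m + n * (τ : ℂ)), ?_, p3 m n w⟩
    rw [mem_closedBall_zero_iff]
    refine (Complex.norm_le_abs_re_add_abs_im _).trans (add_le_add ?_ ?_)
    · have e : (w - (m + n * (τ : ℂ))).re = (w - n * (τ : ℂ)).re - m := by simp; ring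
      rw [e, abs_le]
      have := Int.floor_le (w - n * (τ : ℂ)).re
      have := Int.lt_floor_add_one (w - n * (τ : ℂ)).re
      constructor <;> linarith
    · have e : (w - (m + n * (τ : ℂ))).im = w.im - n * τ.im := by simp
      have hp := τ.im_pos
      rw [e, abs_le]
      have a := Int.floor_le (w.im / τ.im)
      have b := Int.lt_floor_add_one (w.im / τ.im)
      rw [le_div_iff₀ hp] at a
      rw [div_lt_iff₀ hp] at b
      constructor <;> linarith
  have key := gd.apply_eq_apply_of_bounded gb z 0
  have hg0 : g 0 = c := by simp [hg, hB0]
  by_cases h0 : B z = 0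
  · have : A z = 0 := by
      obtain ⟨m, n, rfl⟩ := hz z h0
      have i1 : ∀ z, A z = 0 ↔ A (z + 1) = 0 := fun z => by
        obtain ⟨u, hu, ha, hb⟩ := h1 z
        simp [ha, hu]
      have i2 : ∀ z, A z = 0 ↔ A (z + τ) = 0 := fun z => by
        obtain ⟨u, hu, ha, hb⟩ := h2 z
        simp [ha, hu]
      have q1 : Function.Periodic (fun z => A z = 0) 1 := fun z => propext (i1 z).symm
      have q2 : Function.Periodic (fun z => A z = 0) (τ : ℂ) := fun z => propext (i2 z).symm
      have a := (q1.int_mul m) 0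
      have b := (q2.int_mul n) (0 + m * 1)
      simp only [zero_add, mul_one] at a b
      rw [b, a]; exact hA0
    simp [this, h0]
  · rw [hg0] at key
    simp only [hg, if_neg h0, hc] at key
    field_simp at key
    linear_combination key

/-- the basic product -/
def PP (τ z : ℂ) : ℂ := ∏' n : ℕ, (1 - cexp (2 * (π : ℂ) * Complex.I * (z + n * τ)))

lemma nrm (τ z : ℂ) (n : ℕ) : ‖-cexp (2 * (π : ℂ) * Complex.I * (z + n * τ))‖ =
    rexp (-2 * π * z.im) * rexp (-2 * π * τ.im) ^ n := by
  rw [norm_neg, Complex.norm_exp, ← Real.exp_nat_mul, ← Real.exp_add]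
  congr 1
  simp
  ring

lemma sumgeo (τ : ℍ) (C : ℝ) : Summable fun n : ℕ => C * rexp (-2 * π * (τ : ℂ).im) ^ n := by
  apply Summable.mul_left
  apply summable_geometric_of_lt_one (Real.exp_pos _).le
  rw [Real.exp_lt_one_iff]
  have := mul_pos Real.pi_pos τ.im_pos
  simp only [UpperHalfPlane.coe_im]
  linarith

lemma sm (τ : ℍ) (z : ℂ) :
    Summable fun n : ℕ => ‖-cexp (2 * (π : ℂ) * Complex.I * (z + n * τ))‖ := by
  simp_rw [nrm]; exact sumgeo τ _

lemma mpl (τ : ℍ) (z : ℂ) :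
    Multipliable fun n : ℕ => (1 - cexp (2 * (π : ℂ) * Complex.I * (z + n * τ))) := by
  simp_rw [sub_eq_add_neg]
  exact multipliable_one_add_of_summable (sm τ z)

lemma PP_succ (τ : ℍ) (z : ℂ) :
    PP τ z = (1 - cexp (2 * (π : ℂ) * Complex.I * z)) * PP τ (z + τ) := by
  have e : ∀ n : ℕ, z + ((n + 1 : ℕ) : ℂ) * (τ : ℂ) = z + τ + n * τ := by
    intro n; push_cast; ring
  have h := mpl τ (z + τ)
  unfold PP
  rw [tprod_eq_zero_mul']
  · simp_rw [e]; simp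
  · simp_rw [e]; exact h

lemma PP_diff (τ : ℍ) : Differentiable ℂ (PP τ) := by
  intro w
  set K : Set ℂ := {z | w.im - 1 < z.im}
  have hK : IsOpen K := isOpen_lt continuous_const Complex.continuous_im
  have hw : w ∈ K := by simp [K]
  have h := Summable.hasProdLocallyUniformlyOn_nat_one_add hK
    (sumgeo τ (rexp (-2 * π * (w.im - 1))))
    (f := fun n z => -cexp (2 * (π : ℂ) * Complex.I * (z + n * τ)))
    (.of_forall fun n z hz => by
      rw [nrm]
      have : w.im - 1 < z.im := hz
      refine mul_le_mul_of_nonneg_right (Real.exp_le_exp.2 ?_) (by positivity)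
      nlinarith [Real.pi_pos]) (fun n => by fun_prop)
  have h2 := h.differentiableOn (.of_forall fun s => by
    simpa [Finset.prod_fn] using
      DifferentiableOn.finsetProd (fun _ _ ↦ by fun_prop)) hK
  have h3 : PP τ = fun z => ∏' n : ℕ, (1 + -cexp (2 * (π : ℂ) * Complex.I * (z + n * τ))) := by
    funext z; simp [PP, sub_eq_add_neg]
  rw [h3]
  exact (h2 w hw).differentiableAt (hK.mem_nhds hw)

lemma PP_zero (τ : ℍ) (z : ℂ) (h : PP τ z = 0) : ∃ (m : ℤ) (n : ℕ), z = m - n * (τ : ℂ) := by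
  by_contra! hc
  refine tprod_one_add_ne_zero_of_summable
    (f := fun n : ℕ => -cexp (2 * (π : ℂ) * Complex.I * (z + n * τ))) ?_ (sm τ z) ?_
  · intro n hn
    have : cexp (2 * (π : ℂ) * Complex.I * (z + n * τ)) = 1 := by linear_combination -hn
    rw [Complex.exp_eq_one_iff] at this
    obtain ⟨m, hm⟩ := this
    apply hc m n
    have hp : (2 * (π : ℂ) * Complex.I) ≠ 0 := Complex.two_pi_I_ne_zero
    have : z + n * τ = m := mul_left_cancel₀ hp (by linear_combination hm)
    linear_combination this
  · simpa [PP, sub_eq_add_neg] using h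

lemma PP_add_one (τ z : ℂ) : PP τ (z + 1) = PP τ z := by
  unfold PP
  congr 1; funext n
  rw [show 2 * (π : ℂ) * Complex.I * (z + 1 + n * τ) =
    2 * (π : ℂ) * Complex.I * (z + n * τ) + 2 * π * Complex.I by ring, Complex.exp_periodic]

lemma th_eq (τ : ℍ) (z : ℂ) : th11 τ z = cexp (2 * (π : ℂ) * Complex.I * τ / 8) *
    cexp (-(π : ℂ) * Complex.I * (z + 1 / 2)) * (PP τ τ * PP τ z * PP τ (τ - z)) := by
  unfold th11 PP
  rw [← Multipliable.tprod_mul (mpl τ τ) (mpl τ z),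
    ← Multipliable.tprod_mul ((mpl τ τ).mul (mpl τ z)) (mpl τ (τ - z))]
  congr 2; funext n
  rw [← Complex.exp_add, ← Complex.exp_add]
  ring_nf

lemma eta_eq (τ : ℂ) : dedekindEta τ = cexp (2 * (π : ℂ) * Complex.I * τ / 24) * PP τ τ := by
  unfold dedekindEta PP
  congr 2; funext n
  ring_nf

lemma eta_eq' (τ : ℂ) : dedekindEta τ = ModularForm.eta τ := by
  unfold dedekindEta ModularForm.eta
  simp_rw [ModularForm.eta_q_eq_cexp]
  have e1 : Function.Periodic.qParam 24 τ = cexp (2 * (π : ℂ) * Complex.I * τ / 24) := by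
    simp [Function.Periodic.qParam]
  rw [e1]
  congr 2; funext n; ring_nf

lemma eta_S (τ : ℍ) : ∃ ρ : ℂ, ρ ^ 2 = -Complex.I * τ ∧
    dedekindEta (-1 / (τ : ℂ)) = ρ * dedekindEta τ := by
  have h := ModularForm.eta_comp_eq_csqrt_I_inv (x := (τ : ℂ)) τ.2
  refine ⟨(Complex.sqrt Complex.I)⁻¹ * Complex.sqrt τ, ?_, ?_⟩
  · rw [mul_pow, inv_pow]
    have hs : ∀ w : ℂ, Complex.sqrt w ^ 2 = w := by
      intro w
      simp [Complex.sqrt]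
    rw [hs, hs, Complex.inv_I]
  · rw [eta_eq', eta_eq']
    simpa [mul_assoc] using h

lemma eta_ne (τ : ℍ) : dedekindEta τ ≠ 0 := by
  rw [eta_eq']; exact ModularForm.eta_ne_zero τ.2

lemma th_diff (τ : ℍ) : Differentiable ℂ (th11 τ) := by
  have : th11 τ = fun z => cexp (2 * (π : ℂ) * Complex.I * τ / 8) *
    cexp (-(π : ℂ) * Complex.I * (z + 1 / 2)) * (PP τ τ * PP τ z * PP τ (τ - z)) := by
    funext z; exact th_eq τ z
  rw [this]
  have := PP_diff τ
  fun_prop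

lemma th_deriv (τ : ℍ) : HasDerivAt (th11 τ) (-2 * π * dedekindEta τ ^ 3) 0 := by
  have hP := PP_diff τ
  set F : ℂ → ℂ := fun z => cexp (2 * (π : ℂ) * Complex.I * τ / 8) *
    cexp (-(π : ℂ) * Complex.I * (z + 1 / 2)) * (PP τ τ * PP τ (z + τ) * PP τ (τ - z)) with hF
  have e : th11 τ = fun z => (1 - cexp (2 * (π : ℂ) * Complex.I * z)) * F z := by
    funext z; rw [th_eq, PP_succ τ z]; simp only [hF]; ring
  have dF : Differentiable ℂ F := by rw [hF]; fun_prop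
  have d1 : HasDerivAt (fun z : ℂ => 1 - cexp (2 * (π : ℂ) * Complex.I * z))
      (-(2 * (π : ℂ) * Complex.I)) 0 := by
    have := (((hasDerivAt_id (0 : ℂ)).const_mul (2 * (π : ℂ) * Complex.I)).cexp).const_sub 1
    simpa using this
  rw [e]
  refine (d1.mul (dF 0).hasDerivAt).congr_deriv ?_
  have e2 : cexp (-(π : ℂ) * Complex.I * (0 + 1 / 2)) = -Complex.I := by
    rw [show -(π : ℂ) * Complex.I * (0 + 1 / 2) = -(π / 2 * Complex.I) by ring, Complex.exp_neg,
      Complex.exp_pi_div_two_mul_I, Complex.inv_I]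
  have e3 : cexp (2 * (π : ℂ) * Complex.I * τ / 24) ^ 3 = cexp (2 * (π : ℂ) * Complex.I * τ / 8) := by
    rw [← Complex.exp_nat_mul]; congr 1; push_cast; ring
  simp only [hF]
  rw [eta_eq, mul_pow, e3, e2]
  simp only [mul_zero, Complex.exp_zero, sub_self, zero_mul, add_zero, zero_add, sub_zero]
  linear_combination (-(-2) * π * cexp (2 * (π : ℂ) * Complex.I * τ / 8) * PP τ τ ^ 3) * Complex.I_sq

lemma th_zero0 (τ : ℍ) : th11 τ 0 = 0 := by
  rw [th_eq, PP_succ τ 0]; simp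

lemma th_add_one (τ : ℍ) (z : ℂ) : th11 τ (z + 1) = -th11 τ z := by
  rw [th_eq, th_eq, PP_add_one, ← PP_add_one τ (τ - (z + 1))]
  rw [show (τ : ℂ) - (z + 1) + 1 = τ - z by ring,
    show -(π : ℂ) * Complex.I * (z + 1 + 1 / 2) =
      -(π : ℂ) * Complex.I * (z + 1 / 2) + -(π * Complex.I) by ring, Complex.exp_add,
    Complex.exp_neg (π * Complex.I), Complex.exp_pi_mul_I]
  norm_num

lemma th_add_tau (τ : ℍ) (z : ℂ) : th11 τ (z + τ) =
    -cexp (-(π : ℂ) * Complex.I * (2 * z + τ)) * th11 τ z := by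
  rw [th_eq, th_eq, PP_succ τ z, PP_succ τ (τ - (z + τ))]
  rw [show (τ : ℂ) - (z + τ) + τ = τ - z by ring,
    show -(π : ℂ) * Complex.I * (z + τ + 1 / 2) =
      -(π : ℂ) * Complex.I * (z + 1 / 2) + -(π * Complex.I) * τ by ring, Complex.exp_add,
    show -(π : ℂ) * Complex.I * (2 * z + τ) =
      -(2 * π * Complex.I * z) + -(π * Complex.I) * τ by ring, Complex.exp_add,
    show 2 * (π : ℂ) * Complex.I * (τ - (z + τ)) = -(2 * π * Complex.I * z) by ring]
  have h : cexp (2 * π * Complex.I * z) * cexp (-(2 * π * Complex.I * z)) = 1 := by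
    rw [← Complex.exp_add]; simp
  have h' : (1 - cexp (-(2 * π * Complex.I * z))) =
      -cexp (-(2 * π * Complex.I * z)) * (1 - cexp (2 * π * Complex.I * z)) := by
    linear_combination -h
  rw [h']
  ring

lemma th_zero (τ : ℍ) (z : ℂ) (h : th11 τ z = 0) : ∃ m n : ℤ, z = m + n * (τ : ℂ) := by
  rw [th_eq] at h
  have hη := eta_ne τ
  rw [eta_eq] at hη
  have h0 := right_ne_zero_of_mul hη
  simp only [mul_eq_zero, Complex.exp_ne_zero, false_or, h0] at h
  rcases h with h | h
  · obtain ⟨m, n, e⟩ := PP_zero τ _ h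
    exact ⟨m, -n, by push_cast; linear_combination e⟩
  · obtain ⟨m, n, e⟩ := PP_zero τ _ h
    exact ⟨-m, n + 1, by push_cast; linear_combination -e⟩

lemma th_S (τ : ℍ) (z : ℂ) : th11 (-1 / (τ : ℂ)) (z / τ) * dedekindEta τ ^ 3 * τ =
    dedekindEta (-1 / (τ : ℂ)) ^ 3 * (cexp (π * Complex.I * z ^ 2 / τ) * th11 τ z) := by
  have hτ : (τ : ℂ) ≠ 0 := τ.ne_zero
  obtain ⟨σ, hσ⟩ : ∃ σ : ℍ, (σ : ℂ) = -1 / (τ : ℂ) :=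
    ⟨.mk _ τ.im_inv_neg_coe_pos, by
      simp [neg_div, inv_neg]⟩
  rw [← hσ]
  have hdA : HasDerivAt (fun z => th11 σ (z / τ)) (-2 * π * dedekindEta σ ^ 3 * (1 / τ)) 0 := by
    have h0 : HasDerivAt (th11 σ) (-2 * π * dedekindEta σ ^ 3) ((0 : ℂ) / τ) := by
      rw [zero_div]; exact th_deriv σ
    exact h0.comp (0 : ℂ) ((hasDerivAt_id (0 : ℂ)).div_const (τ : ℂ))
  have hdB : HasDerivAt (fun z => cexp (π * Complex.I * z ^ 2 / τ) * th11 τ z)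
      (-2 * π * dedekindEta τ ^ 3) 0 := by
    have h0 : DifferentiableAt ℂ (fun z => cexp (π * Complex.I * z ^ 2 / (τ : ℂ))) 0 := by fun_prop
    refine (h0.hasDerivAt.mul (th_deriv τ)).congr_deriv ?_
    simp [th_zero0]
  have hdiffσ := th_diff σ
  have hdiffτ := th_diff τ
  have key := liou τ (fun z => th11 σ (z / τ))
    (fun z => cexp (π * Complex.I * z ^ 2 / τ) * th11 τ z) (by fun_prop) (by fun_prop)
    (by simp [th_zero0]) (by simp [th_zero0])
    (by
      rw [hdB.deriv]
      have := eta_ne τ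
      have hp : (π : ℂ) ≠ 0 := by exact_mod_cast Real.pi_ne_zero
      simp [this, hp])
    (by
      intro w hw
      simp only [mul_eq_zero, Complex.exp_ne_zero, false_or] at hw
      exact th_zero τ w hw)
    (by
      intro w
      refine ⟨-cexp (π * Complex.I * (2 * w + 1) / τ), by simp, ?_, ?_⟩
      · have h := th_add_tau σ ((w + 1) / τ)
        have e : (w + 1) / τ + σ = w / (τ : ℂ) := by rw [hσ]; field_simp; ring
        rw [e] at h
        simp only [h]
        rw [neg_mul, neg_mul, neg_mul, mul_neg, neg_neg, ← mul_assoc, ← Complex.exp_add]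
        rw [show π * Complex.I * (2 * w + 1) / τ +
          -(π * Complex.I) * (2 * ((w + 1) / τ) + σ) = 0 by rw [hσ]; field_simp; ring]
        simp
      · simp only [th_add_one]
        rw [show π * Complex.I * (w + 1) ^ 2 / (τ : ℂ) = π * Complex.I * (2 * w + 1) / τ +
          π * Complex.I * w ^ 2 / τ by ring, Complex.exp_add]
        ring)
    (by
      intro w
      refine ⟨-1, by simp, ?_, ?_⟩
      · have e : (w + τ) / (τ : ℂ) = w / τ + 1 := by field_simp
        simp only [e, th_add_one]; ring
      · simp only [th_add_tau]
        rw [← mul_assoc, mul_neg, ← Complex.exp_add,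
          show π * Complex.I * (w + τ) ^ 2 / (τ : ℂ) + -π * Complex.I * (2 * w + τ) =
            π * Complex.I * w ^ 2 / τ by field_simp; ring]
        ring) z
  rw [hdA.deriv, hdB.deriv] at key
  have hp : (π : ℂ) ≠ 0 := by exact_mod_cast Real.pi_ne_zero
  have k2 : (-2 * π : ℂ) ≠ 0 := by simp [hp]
  apply mul_left_cancel₀ k2
  have k3 : (τ : ℂ) * (1 / τ) = 1 := by field_simp
  linear_combination τ * key - 2 * π * dedekindEta σ ^ 3 *
    (cexp (π * Complex.I * z ^ 2 / τ) * th11 τ z) * k3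

lemma th_S' (τ : ℍ) (ρ : ℂ) (hρ : dedekindEta (-1 / (τ : ℂ)) = ρ * dedekindEta τ) (z : ℂ) :
    th11 (-1 / (τ : ℂ)) (z / τ) =
      ρ ^ 3 / τ * (cexp (π * Complex.I * z ^ 2 / τ) * th11 τ z) := by
  have h := th_S τ z
  have hτ : (τ : ℂ) ≠ 0 := τ.ne_zero
  have hη := eta_ne τ
  rw [hρ] at h
  rw [div_mul_eq_mul_div, eq_div_iff hτ]
  apply mul_right_cancel₀ (pow_ne_zero 3 hη)
  linear_combination h

/-- `S`-transformation of the denominator: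
`τ^{−1} R(−1/τ, z₁/τ, z₂/τ, t − (z₁²+z₂²)/(2τ)) = −i R(τ, z₁, z₂, t)`. -/
theorem statement10 (τ : ℍ) (z₁ z₂ t : ℂ) :
    (τ : ℂ)⁻¹ *
      Rden (-1 / (τ : ℂ)) (z₁ / (τ : ℂ)) (z₂ / (τ : ℂ))
        (t - (z₁ ^ 2 + z₂ ^ 2) / (2 * (τ : ℂ))) =
    -Complex.I * Rden (τ : ℂ) z₁ z₂ t := by
  obtain ⟨ρ, h2, hρ⟩ := eta_S τ
  have hτ : (τ : ℂ) ≠ 0 := τ.ne_zero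
  have hη := eta_ne τ
  have hρ0 : ρ ≠ 0 := by
    rintro rfl
    simp [hτ] at h2
  unfold Rden
  rw [← sub_div, ← add_div]
  simp only [th_S' τ ρ hρ]
  rw [hρ, mul_zpow]
  have e : cexp (6 * π * Complex.I * (t - (z₁ ^ 2 + z₂ ^ 2) / (2 * (τ : ℂ)))) *
      cexp (π * Complex.I * z₁ ^ 2 / τ) * cexp (π * Complex.I * z₂ ^ 2 / τ) *
      cexp (π * Complex.I * (z₁ - z₂) ^ 2 / τ) * cexp (π * Complex.I * (z₁ + z₂) ^ 2 / τ) =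
      cexp (6 * π * Complex.I * t) := by
    simp only [← Complex.exp_add]
    congr 1
    field_simp
    ring
  have e5 : (τ : ℂ)⁻¹ * (ρ ^ (-2 : ℤ) * (ρ ^ 3 / τ) ^ 4) = -Complex.I := by
    rw [show (-2 : ℤ) = -((2 : ℕ) : ℤ) by norm_num, zpow_neg, zpow_natCast]
    have : (ρ ^ 2)⁻¹ * (ρ ^ 3 / τ) ^ 4 = (ρ ^ 2) ^ 5 / (τ : ℂ) ^ 4 := by
      field_simp
    rw [this, h2, neg_mul, neg_pow, mul_pow, Complex.I_pow_eq_pow_mod]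
    field_simp
    norm_num
  rw [← e, ← e5]
  ring

end
end

section
/- Let K be an integer with K ≥ −1, set m := 2(K+3), and let n₁, n₂ be positive integers with n₁ < m, n₂ < m and n₁ − n₂ odd. Then for every τ ∈ ℍ and every z ∈ ℂ: e^{πi(K+3)τ/2} · (θ_{n₁,m} − θ_{−n₁,m})(τ, −z − τ/2) · (θ_{n₂,m} − θ_{−n₂,m})(τ, z − τ/2) = (θ_{−n₁+(K+3),m} − θ_{n₁+(K+3),m})(τ, z) · (θ_{n₂−(K+3),m} − θ_{−n₂−(K+3),m})(τ, z). (The left-hand side, multiplied by e^{4πi(K+3)t}, is the numerator of the character of the quantum Hamiltonian reduction of the admissible C₂⁽¹⁾-module L(Λ^{[K]}_{n₁,n₂}) with respect to the minimal nilpotent element, in the Ramond sector.) -/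
noncomputable section

open Complex Real UpperHalfPlane

/-- The Jacobi theta function
`θ_{j,m}(τ,z) := Σ_{n∈ℤ} e^{2πi m (n + j/(2m)) z} e^{2πi τ m (n + j/(2m))²}`. -/
def jacobiTh (m j : ℤ) (τ z : ℂ) : ℂ :=
  ∑' n : ℤ,
    Complex.exp (2 * (π : ℂ) * Complex.I * (m : ℂ) * ((n : ℂ) + (j : ℂ) / (2 * (m : ℂ))) * z) *
    Complex.exp (2 * (π : ℂ) * Complex.I * τ * (m : ℂ) * ((n : ℂ) + (j : ℂ) / (2 * (m : ℂ))) ^ 2)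

theorem jacobiTh_neg (m j : ℤ) (τ z : ℂ) : jacobiTh m j τ (-z) = jacobiTh m (-j) τ z := by
  unfold jacobiTh
  rw [← (Equiv.neg ℤ).tsum_eq]
  refine tsum_congr fun n => ?_
  simp only [Equiv.neg_apply]
  push_cast
  congr 2 <;> ring

theorem jacobiTh_shift (p j : ℤ) (hp : (p : ℂ) ≠ 0) (τ z : ℂ) :
    jacobiTh (2 * p) j τ (z - τ / 2) =
      Complex.exp ((π : ℂ) * Complex.I * p * z - (π : ℂ) * Complex.I * p * τ / 2 / 2) *
        jacobiTh (2 * p) (j - p) τ z := by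
  unfold jacobiTh
  rw [← tsum_mul_left]
  refine tsum_congr fun n => ?_
  rw [← Complex.exp_add, ← Complex.exp_add, ← Complex.exp_add]
  push_cast
  congr 1
  field_simp
  ring

/-- With `m = 2(K+3)`, for `τ ∈ ℍ` and `z ∈ ℂ`:
`e^{πi(K+3)τ/2} (θ_{n₁,m} − θ_{−n₁,m})(τ, −z−τ/2) (θ_{n₂,m} − θ_{−n₂,m})(τ, z−τ/2)
 = (θ_{−n₁+(K+3),m} − θ_{n₁+(K+3),m})(τ,z) (θ_{n₂−(K+3),m} − θ_{−n₂−(K+3),m})(τ,z)`,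
the Ramond-sector numerator identity of the quantum Hamiltonian reduction. -/
theorem statement15 (K : ℤ) (hK : -1 ≤ K) (n₁ n₂ : ℤ)
    (hn₁ : 0 < n₁) (hn₂ : 0 < n₂)
    (hn₁' : n₁ < 2 * (K + 3)) (hn₂' : n₂ < 2 * (K + 3))
    (hodd : Odd (n₁ - n₂)) (τ : ℍ) (z : ℂ) :
    Complex.exp ((π : ℂ) * Complex.I * ((K : ℂ) + 3) * (τ : ℂ) / 2) *
      (jacobiTh (2 * (K + 3)) n₁ (τ : ℂ) (-z - (τ : ℂ) / 2) -
        jacobiTh (2 * (K + 3)) (-n₁) (τ : ℂ) (-z - (τ : ℂ) / 2)) *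
      (jacobiTh (2 * (K + 3)) n₂ (τ : ℂ) (z - (τ : ℂ) / 2) -
        jacobiTh (2 * (K + 3)) (-n₂) (τ : ℂ) (z - (τ : ℂ) / 2)) =
    (jacobiTh (2 * (K + 3)) (-n₁ + (K + 3)) (τ : ℂ) z -
        jacobiTh (2 * (K + 3)) (n₁ + (K + 3)) (τ : ℂ) z) *
      (jacobiTh (2 * (K + 3)) (n₂ - (K + 3)) (τ : ℂ) z -
        jacobiTh (2 * (K + 3)) (-n₂ - (K + 3)) (τ : ℂ) z) := by
  have hp : ((K + 3 : ℤ) : ℂ) ≠ 0 := by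
    have : K + 3 ≠ 0 := by omega
    exact_mod_cast this
  rw [jacobiTh_shift _ _ hp, jacobiTh_shift _ _ hp, jacobiTh_shift _ _ hp,
    jacobiTh_shift _ _ hp, jacobiTh_neg, jacobiTh_neg,
    show -(n₁ - (K + 3)) = -n₁ + (K + 3) by ring, show -(-n₁ - (K + 3)) = n₁ + (K + 3) by ring]
  rw [← mul_sub, ← mul_sub]
  have key : Complex.exp ((π : ℂ) * Complex.I * ((K : ℂ) + 3) * (τ : ℂ) / 2) *
      Complex.exp ((π : ℂ) * Complex.I * ((K + 3 : ℤ) : ℂ) * (-z) -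
        (π : ℂ) * Complex.I * ((K + 3 : ℤ) : ℂ) * τ / 2 / 2) *
      Complex.exp ((π : ℂ) * Complex.I * ((K + 3 : ℤ) : ℂ) * z -
        (π : ℂ) * Complex.I * ((K + 3 : ℤ) : ℂ) * τ / 2 / 2) = 1 := by
    rw [← Complex.exp_add, ← Complex.exp_add, ← Complex.exp_zero]
    push_cast
    congr 1
    ring
  generalize jacobiTh (2 * (K + 3)) (-n₁ + (K + 3)) (τ : ℂ) z -
        jacobiTh (2 * (K + 3)) (n₁ + (K + 3)) (τ : ℂ) z = A
  generalize jacobiTh (2 * (K + 3)) (n₂ - (K + 3)) (τ : ℂ) z -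
        jacobiTh (2 * (K + 3)) (-n₂ - (K + 3)) (τ : ℂ) z = B
  linear_combination A * B * key

end
end
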